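/- arXiv:1806.02943 — 4 statements merged into one kernel-verified Lean document; each statement's English description precedes it below -/
import Mathlib

section
/- For all integers 1 ≤ k ≤ n and 0 ≤ p ≤ binomial(n,k), the p-th elementary symmetric polynomial e_p(X^{(k)}) of the alphabet X^{(k)} = { ∑_{i ∈ S} x_i : S ⊆ [n], |S| = k } is Schur-positive in x_1,…,x_n: there exist nonnegative integers c_λ, indexed by partitions λ of p with at most n parts, such that e_p(X^{(k)}) = ∑_λ c_λ · s_λ(x_1,…,x_n). -/
open MvPolynomial

/-- Complete homogeneous symmetric polynomial with integer index: `0` for negative index. -/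
noncomputable def hInt (n : ℕ) (m : ℤ) : MvPolynomial (Fin n) ℚ :=
  if 0 ≤ m then hsymm (Fin n) ℚ m.toNat else 0

/-- Schur polynomial via the Jacobi–Trudi determinant. -/
noncomputable def schur (n : ℕ) (lam : Fin n → ℕ) : MvPolynomial (Fin n) ℚ :=
  (Matrix.of fun i j : Fin n => hInt n ((lam i : ℤ) - (i : ℤ) + (j : ℤ))).det

/-- The `p`-th elementary symmetric polynomial of the alphabet
`X^{(k)} = { ∑_{i ∈ S} x_i : S ⊆ [n], |S| = k }`. -/
noncomputable def esymmAlphabet (n k p : ℕ) : MvPolynomial (Fin n) ℚ :=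
  ∑ F ∈ ((Finset.univ : Finset (Fin n)).powersetCard k).powersetCard p,
    ∏ S ∈ F, ∑ i ∈ S, X i

namespace SchurPositivity

/-! ### Dominance order and dominance-leading terms -/

/-- The sum of the first `r` entries of `d`. -/
def prefixSum {n : ℕ} (d : Fin n → ℕ) (r : ℕ) : ℕ :=
  ∑ i : Fin n, if (i : ℕ) < r then d i else 0

/-- Dominance: `d` and `e` have the same sum, and every prefix sum of `d` is at most that of `e`. -/
def Dominated {n : ℕ} (d e : Fin n → ℕ) : Prop :=
  (∀ r, prefixSum d r ≤ prefixSum e r) ∧ ∑ i, d i = ∑ i, e i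

theorem prefixSum_add {n : ℕ} (d e : Fin n → ℕ) (r : ℕ) :
    prefixSum (d + e) r = prefixSum d r + prefixSum e r := by
  simp only [prefixSum, ← Finset.sum_add_distrib, Pi.add_apply]
  refine Finset.sum_congr rfl fun i _ => ?_
  split_ifs <;> simp

theorem prefixSum_succ {n : ℕ} (d : Fin n → ℕ) (i : Fin n) :
    prefixSum d (i + 1) = prefixSum d i + d i := by
  have h : d i = ∑ j, if j = i then d j else 0 := by simp
  rw [h, prefixSum, prefixSum, ← Finset.sum_add_distrib]
  refine Finset.sum_congr rfl fun j _ => ?_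
  by_cases hj : j = i
  · subst hj; simp
  · have : (j : ℕ) ≠ i := fun h => hj (Fin.ext h)
    have : (j : ℕ) < i + 1 ↔ (j : ℕ) < i := by omega
    simp [hj, this]

theorem eq_of_prefixSum_eq {n : ℕ} {d e : Fin n → ℕ} (h : ∀ r, prefixSum d r = prefixSum e r) :
    d = e := by
  funext i
  have h1 := prefixSum_succ d i
  have h2 := prefixSum_succ e i
  rw [h, h] at h1
  omega

theorem Dominated.refl {n : ℕ} (d : Fin n → ℕ) : Dominated d d := ⟨fun _ => le_rfl, rfl⟩

theorem Dominated.trans {n : ℕ} {d e f : Fin n → ℕ} (h : Dominated d e) (h' : Dominated e f) :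
    Dominated d f := ⟨fun r => (h.1 r).trans (h'.1 r), h.2.trans h'.2⟩

theorem Dominated.antisymm {n : ℕ} {d e : Fin n → ℕ} (h : Dominated d e) (h' : Dominated e d) :
    d = e := eq_of_prefixSum_eq fun r => le_antisymm (h.1 r) (h'.1 r)

theorem Dominated.add {n : ℕ} {d e d' e' : Fin n → ℕ} (h : Dominated d e) (h' : Dominated d' e') :
    Dominated (d + d') (e + e') := by
  refine ⟨fun r => ?_, by simp [Finset.sum_add_distrib, h.2, h'.2]⟩
  rw [prefixSum_add, prefixSum_add]
  exact add_le_add (h.1 r) (h'.1 r)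

theorem Dominated.eq_of_add_eq {n : ℕ} {d e d' e' : Fin n → ℕ} (h : Dominated d e)
    (h' : Dominated d' e') (heq : d + d' = e + e') : d = e := by
  refine eq_of_prefixSum_eq fun r => ?_
  have h1 := prefixSum_add d d' r
  rw [heq, prefixSum_add] at h1
  have := h.1 r
  have := h'.1 r
  omega

/-- All exponents of `g` are dominated by `μ`, at which the coefficient is `a`. -/
def HasLead {n : ℕ} (g : MvPolynomial (Fin n) ℤ) (μ : Fin n →₀ ℕ) (a : ℤ) : Prop :=
  (∀ d, coeff d g ≠ 0 → Dominated d μ) ∧ coeff μ g = a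

theorem HasLead.mul {n : ℕ} {g h : MvPolynomial (Fin n) ℤ} {μ ν : Fin n →₀ ℕ} {a b : ℤ}
    (hg : HasLead g μ a) (hh : HasLead h ν b) : HasLead (g * h) (μ + ν) (a * b) := by
  constructor
  · intro d hd
    rw [coeff_mul] at hd
    obtain ⟨x, hx, hne⟩ := Finset.exists_ne_zero_of_sum_ne_zero hd
    rw [Finset.HasAntidiagonal.mem_antidiagonal] at hx
    rw [← hx, Finsupp.coe_add, Finsupp.coe_add]
    exact (hg.1 _ (left_ne_zero_of_mul hne)).add (hh.1 _ (right_ne_zero_of_mul hne))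
  · rw [coeff_mul, Finset.sum_eq_single (μ, ν), hg.2, hh.2]
    · rintro ⟨x, y⟩ hx hne
      rw [Finset.HasAntidiagonal.mem_antidiagonal] at hx
      by_contra hc
      have h1 := hg.1 _ (left_ne_zero_of_mul hc)
      have h2 := hh.1 _ (right_ne_zero_of_mul hc)
      have hx' : (x : Fin n → ℕ) + y = μ + ν := by rw [← Finsupp.coe_add, ← Finsupp.coe_add, hx]
      have e1 : x = μ := DFunLike.coe_injective (h1.eq_of_add_eq h2 hx')
      subst e1
      exact hne (Prod.ext rfl (add_left_cancel hx))
    · simp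

theorem HasLead.prod {n : ℕ} {ι : Type*} (s : Finset ι) (g : ι → MvPolynomial (Fin n) ℤ)
    (μ : ι → Fin n →₀ ℕ) (h : ∀ i ∈ s, HasLead (g i) (μ i) 1) :
    HasLead (∏ i ∈ s, g i) (∑ i ∈ s, μ i) 1 := by
  classical
  induction s using Finset.induction_on with
  | empty =>
    refine ⟨fun d hd => ?_, by simp⟩
    simp only [Finset.prod_empty, coeff_one, ne_eq, ite_eq_right_iff, one_ne_zero, imp_false,
      not_not] at hd
    simp [← hd, Dominated.refl]
  | insert i s hi ih =>
    rw [Finset.prod_insert hi, Finset.sum_insert hi]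
    simpa using (h i (by simp)).mul (ih fun j hj => h j (by simp [hj]))

/-! ### Complete homogeneous polynomials in the variables from `j` on -/

/-- The complete homogeneous polynomial of degree `m` in the variables `x_i` with `i ≥ j`. -/
noncomputable def hFrom (n j : ℕ) (m : ℕ) : MvPolynomial (Fin n) ℤ :=
  ∑ d ∈ (Finset.univ.filter fun i : Fin n => j ≤ i).finsuppAntidiag m, monomial d 1

theorem coeff_hFrom (n j m : ℕ) (d : Fin n →₀ ℕ) :
    coeff d (hFrom n j m) = if ∑ i, d i = m ∧ ∀ i : Fin n, (i : ℕ) < j → d i = 0 then 1 else 0 := by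
  have key : d ∈ (Finset.univ.filter fun i : Fin n => j ≤ i).finsuppAntidiag m ↔
      ∑ i, d i = m ∧ ∀ i : Fin n, (i : ℕ) < j → d i = 0 := by
    rw [Finset.mem_finsuppAntidiag]
    have h2 : d.support ⊆ (Finset.univ.filter fun i : Fin n => j ≤ i) ↔
        ∀ i : Fin n, (i : ℕ) < j → d i = 0 := by
      simp only [Finset.subset_iff, Finsupp.mem_support_iff, Finset.mem_filter, Finset.mem_univ,
        true_and]
      exact forall_congr' fun i => by rw [← not_imp_not]; simp
    rw [h2]
    refine and_congr_left fun h => ?_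
    rw [Finset.sum_filter_of_ne]
    intro i _ hi
    by_contra hc
    exact hi (h i (by omega))
  rw [hFrom, coeff_sum]
  simp only [coeff_monomial, Finset.sum_ite_eq', key]

/-- `hFrom` with an integer index. -/
noncomputable def hFromInt (n j : ℕ) (m : ℤ) : MvPolynomial (Fin n) ℤ :=
  if 0 ≤ m then hFrom n j m.toNat else 0

theorem hFromInt_natCast (n j m : ℕ) : hFromInt n j m = hFrom n j m := by simp [hFromInt]

theorem coeff_hFromInt (n j : ℕ) (m : ℤ) (d : Fin n →₀ ℕ) :
    coeff d (hFromInt n j m) =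
      if ((∑ i, d i : ℕ) : ℤ) = m ∧ ∀ i : Fin n, (i : ℕ) < j → d i = 0 then 1 else 0 := by
  rw [hFromInt]
  split_ifs with h1 h2 h2
  · rw [coeff_hFrom, if_pos ⟨by omega, h2.2⟩]
  · rw [coeff_hFrom, if_neg fun h => h2 ⟨by omega, h.2⟩]
  · exact absurd (h2.1 ▸ Int.natCast_nonneg _) h1
  · simp

theorem hFromInt_succ (n : ℕ) (j : Fin n) (m : ℤ) :
    hFromInt n (j + 1) m = hFromInt n j m - X j * hFromInt n j (m - 1) := by
  rw [eq_sub_iff_add_eq]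
  ext d
  rw [coeff_add, coeff_X_mul', coeff_hFromInt, coeff_hFromInt, coeff_hFromInt]
  have hA : (∀ i : Fin n, (i : ℕ) < j + 1 → d i = 0) ↔
      (∀ i : Fin n, (i : ℕ) < j → d i = 0) ∧ d j = 0 := by
    constructor
    · exact fun h => ⟨fun i hi => h i (by omega), h j (by omega)⟩
    · rintro ⟨h, h'⟩ i hi
      rcases Nat.lt_succ_iff_lt_or_eq.1 hi with h1 | h1
      · exact h i h1
      · rw [Fin.ext h1]; exact h'
  simp only [hA]
  by_cases hj : d j = 0
  · simp [hj]
  · have hs : ∑ i, (d - Finsupp.single j 1 : Fin n →₀ ℕ) i + 1 = ∑ i, d i := by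
      have h1 : Finsupp.single j 1 ≤ d := by
        rw [Finsupp.single_le_iff]; omega
      have h2 : d = (d - Finsupp.single j 1) + Finsupp.single j 1 := (tsub_add_cancel_of_le h1).symm
      conv_rhs => rw [h2]
      simp [Finset.sum_add_distrib]
    have hB : (∀ i : Fin n, (i : ℕ) < j → (d - Finsupp.single j 1 : Fin n →₀ ℕ) i = 0) ↔
        (∀ i : Fin n, (i : ℕ) < j → d i = 0) := by
      refine forall_congr' fun i => imp_congr_right fun hi => ?_
      have : i ≠ j := fun h => by simp [h] at hi
      simp [this.symm]
    simp only [hB]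
    rw [← hs]
    have e : ((∑ i, (d - Finsupp.single j 1 : Fin n →₀ ℕ) i : ℕ) : ℤ) = m - 1 ↔
        ((∑ i, (d - Finsupp.single j 1 : Fin n →₀ ℕ) i + 1 : ℕ) : ℤ) = m := by push_cast; omega
    simp only [e]
    simp [hj]

theorem exists_hFromInt_eq_sum (n j : ℕ) (hj : j ≤ n) :
    ∃ u : ℕ → MvPolynomial (Fin n) ℤ, u 0 = 1 ∧ (∀ k, j < k → u k = 0) ∧
      ∀ m : ℤ, hFromInt n j m = ∑ k ∈ Finset.range (j + 1), u k * hFromInt n 0 (m - k) := by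
  induction j with
  | zero => exact ⟨fun k => if k = 0 then 1 else 0, by simp, fun k hk => by simp; omega, by simp⟩
  | succ j ih =>
    obtain ⟨u, h0, hu, h⟩ := ih (by omega)
    let x : MvPolynomial (Fin n) ℤ := X ⟨j, by omega⟩
    refine ⟨fun k => u k - x * (if k = 0 then 0 else u (k - 1)), by simp [h0], fun k hk => ?_,
      fun m => ?_⟩
    · have : k ≠ 0 := by omega
      simp [this, hu k (by omega), hu (k - 1) (by omega)]
    · have := hFromInt_succ n ⟨j, by omega⟩ m
      simp only at this
      rw [this, h m, h (m - 1)]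
      simp only [sub_mul, Finset.sum_sub_distrib]
      congr 1
      · rw [Finset.sum_range_succ _ (j + 1), hu (j + 1) (by omega)]; simp
      · rw [Finset.sum_range_succ' _ (j + 1), Finset.mul_sum]
        simp only [Nat.add_eq_zero_iff, one_ne_zero, and_false, if_false, if_true, mul_zero,
          zero_mul, add_zero, Nat.add_sub_cancel]
        refine Finset.sum_congr rfl fun k _ => ?_
        rw [mul_assoc]
        congr 3
        push_cast
        ring

theorem hasLead_hFrom (n : ℕ) (j : Fin n) (m : ℕ) :
    HasLead (hFrom n j m) (Finsupp.single j m) 1 := by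
  constructor
  · intro d hd
    rw [coeff_hFrom] at hd
    have hd' := (ite_ne_right_iff.1 hd).1
    refine ⟨fun r => ?_, by simpa using hd'.1⟩
    by_cases hr : (j : ℕ) < r
    · have : prefixSum (Finsupp.single j m) r = m := by
        rw [prefixSum, Finset.sum_eq_single j]
        · simp [hr]
        · intro i _ hi; simp [hi.symm]
        · simp
      rw [this, ← hd'.1]
      refine Finset.sum_le_sum fun i _ => ?_
      split_ifs <;> simp
    · rw [prefixSum, Finset.sum_eq_zero]
      · simp
      · intro i _
        split_ifs with hi
        · exact hd'.2 i (by omega)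
        · rfl
  · rw [coeff_hFrom, if_pos]
    refine ⟨by simp, fun i hi => ?_⟩
    have : j ≠ i := fun h => by simp [h] at hi
    simp [this]

theorem hsymm_eq_hFrom (n m : ℕ) : hsymm (Fin n) ℤ m = hFrom n 0 m := by
  ext d
  rw [coeff_hFrom, hsymm, coeff_sum]
  have h (s : Sym (Fin n) m) : ((s.1.map X).prod : MvPolynomial (Fin n) ℤ) =
      monomial (Multiset.toFinsupp s.1) 1 := by
    induction s.1 using Multiset.induction_on with
    | empty => simp
    | cons a s ih =>
      rw [Multiset.map_cons, Multiset.prod_cons, ih, X, monomial_mul, ← Multiset.singleton_add,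
        map_add, Multiset.toFinsupp_singleton, one_mul]
  simp only [h, coeff_monomial]
  have hcard : ∑ i, d i = Multiset.card (Finsupp.toMultiset d) := by
    rw [Finsupp.card_toMultiset, Finsupp.sum_fintype _ _ fun _ => rfl]
    rfl
  by_cases hd : ∑ i, d i = m
  · rw [if_pos ⟨hd, fun i hi => absurd hi (Nat.not_lt_zero _)⟩,
      Finset.sum_eq_single ⟨Finsupp.toMultiset d, hcard ▸ hd⟩]
    · simp
    · intro s _ hs
      rw [if_neg]
      rintro rfl
      exact hs (Subtype.ext (by simp))
    · exact fun h => absurd (Finset.mem_univ _) h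
  · rw [if_neg fun h => hd h.1]
    refine Finset.sum_eq_zero fun s _ => if_neg ?_
    rintro rfl
    apply hd
    rw [hcard]
    simp

/-! ### The Jacobi–Trudi determinant has leading exponent `μ` -/

/-- The integral Jacobi–Trudi determinant. -/
noncomputable def schurInt (n : ℕ) (μ : Fin n → ℕ) : MvPolynomial (Fin n) ℤ :=
  (Matrix.of fun i j : Fin n => hFromInt n 0 ((μ i : ℤ) - (i : ℤ) + (j : ℤ))).det

theorem schurInt_eq_det_hFromInt (n : ℕ) (μ : Fin n → ℕ) :
    schurInt n μ =
      (Matrix.of fun i j : Fin n => hFromInt n j ((μ i : ℤ) - (i : ℤ) + (j : ℤ))).det := by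
  choose u h0 _ hu using fun j : Fin n => exists_hFromInt_eq_sum n j j.2.le
  let U : Matrix (Fin n) (Fin n) (MvPolynomial (Fin n) ℤ) :=
    Matrix.of fun l j => if l ≤ j then u j (j - l) else 0
  have hU : U.det = 1 := by
    rw [Matrix.det_of_isUpperTriangular]
    · simp [U, h0]
    · intro i j hij
      simp only [id_eq] at hij
      simp [U, not_le.2 hij]
  have hmul : (Matrix.of fun i j : Fin n => hFromInt n j ((μ i : ℤ) - (i : ℤ) + (j : ℤ))) =
      (Matrix.of fun i j : Fin n => hFromInt n 0 ((μ i : ℤ) - (i : ℤ) + (j : ℤ))) * U := by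
    ext1 i j
    simp only [Matrix.mul_apply, Matrix.of_apply, U, hu]
    have hF := Fin.sum_univ_eq_sum_range (fun l : ℕ => hFromInt n 0 ((μ i : ℤ) - (i : ℤ) + (l : ℤ)) *
      if l ≤ (j : ℕ) then u j (j - l) else 0) n
    refine Eq.trans ?_ hF.symm
    rw [← Finset.sum_range_reflect]
    simp only [Nat.add_sub_cancel]
    refine Eq.trans (Finset.sum_congr rfl fun l hl => ?_)
      (Finset.sum_subset (Finset.range_subset_range.2 (show (j : ℕ) + 1 ≤ n from j.2))
        fun l _ hl => ?_)
    · have hl' : l ≤ (j : ℕ) := Nat.lt_succ_iff.1 (Finset.mem_range.1 hl)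
      rw [if_pos hl', mul_comm]
      congr 2
      push_cast [Nat.cast_sub hl']
      ring
    · rw [if_neg (by simpa using hl), mul_zero]
  rw [hmul, Matrix.det_mul, hU, mul_one, schurInt]

theorem prefixSum_perm_le {n : ℕ} (μ : Fin n → ℕ) (hμ : Antitone μ) (σ : Equiv.Perm (Fin n))
    (β : Fin n → ℕ) (hβ : ∀ j, (β j : ℤ) = (μ (σ j) : ℤ) - (σ j : ℕ) + (j : ℕ)) :
    Dominated β μ := by
  have hanti : Antitone fun j : Fin n => (μ j : ℤ) - (j : ℕ) := by
    intro i j hij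
    have h1 := hμ hij
    have h2 : (i : ℕ) ≤ j := hij
    simp only
    omega
  constructor
  · intro r
    have hg : Antitone fun j : Fin n => if (j : ℕ) < r then (1 : ℤ) else 0 := by
      intro i j hij
      have h2 : (i : ℕ) ≤ j := hij
      simp only
      split_ifs <;> omega
    have h := (hanti.monovary hg).sum_comp_perm_mul_le_sum_mul (σ := σ)
    have e1 : (prefixSum β r : ℤ) = ∑ j, ((μ (σ j) : ℤ) - (σ j : ℕ)) *
        (if (j : ℕ) < r then (1 : ℤ) else 0) + ∑ j : Fin n, if (j : ℕ) < r then (j : ℤ) else 0 := by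
      rw [prefixSum, ← Finset.sum_add_distrib]
      push_cast
      refine Finset.sum_congr rfl fun j _ => ?_
      split_ifs <;> simp [hβ]
    have e2 : (prefixSum μ r : ℤ) = ∑ j, ((μ j : ℤ) - (j : ℕ)) *
        (if (j : ℕ) < r then (1 : ℤ) else 0) + ∑ j : Fin n, if (j : ℕ) < r then (j : ℤ) else 0 := by
      rw [prefixSum, ← Finset.sum_add_distrib]
      push_cast
      refine Finset.sum_congr rfl fun j _ => ?_
      split_ifs <;> simp
    zify
    rw [e1, e2]
    gcongr
  · zify
    simp only [hβ, Finset.sum_add_distrib, Finset.sum_sub_distrib]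
    rw [Equiv.sum_comp σ fun j => (μ j : ℤ), Equiv.sum_comp σ fun j : Fin n => ((j : ℕ) : ℤ)]
    ring

/-- The exponent vector as a finitely supported function. -/
noncomputable abbrev expo {n : ℕ} (μ : Fin n → ℕ) : Fin n →₀ ℕ := Finsupp.equivFunOnFinite.symm μ

theorem coeff_schurInt_perm {n : ℕ} (μ : Fin n → ℕ) (hμ : Antitone μ) (σ : Equiv.Perm (Fin n)) :
    HasLead (∏ j : Fin n, hFromInt n j ((μ (σ j) : ℤ) - ((σ j : ℕ) : ℤ) + ((j : ℕ) : ℤ))) (expo μ)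
      (if σ = 1 then 1 else 0) := by
  by_cases hneg : ∃ j, (μ (σ j) : ℤ) - ((σ j : ℕ) : ℤ) + ((j : ℕ) : ℤ) < 0
  · obtain ⟨j, hj⟩ := hneg
    have hσ : σ ≠ 1 := by
      rintro rfl
      simp at hj
      omega
    rw [Finset.prod_eq_zero (Finset.mem_univ j) (by rw [hFromInt, if_neg (by omega)]), if_neg hσ]
    exact ⟨by simp, by simp⟩
  · push Not at hneg
    choose β hβ using fun j => Int.eq_ofNat_of_zero_le (hneg j)
    simp only [hβ, hFromInt_natCast]
    have hlead := HasLead.prod Finset.univ (fun j : Fin n => hFrom n j (β j))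
      (fun j => Finsupp.single j (β j)) fun j _ => hasLead_hFrom n j (β j)
    have hsum : ∑ j, Finsupp.single j (β j) = expo β := by
      ext i; simp [Finsupp.single_apply]
    rw [hsum] at hlead
    have hdom := prefixSum_perm_le μ hμ σ β fun j => (hβ j).symm
    refine ⟨fun d hd => (hlead.1 d hd).trans hdom, ?_⟩
    have hβμ : β = μ ↔ σ = 1 := by
      constructor
      · rintro rfl
        ext j
        have hj := hβ j
        rcases lt_trichotomy (σ j) j with h | h | h
        · have h1 := hμ h.le
          have h2 : (σ j : ℕ) < j := h
          omega
        · simp [h]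
        · have h1 := hμ h.le
          have h2 : (j : ℕ) < σ j := h
          omega
      · rintro rfl
        funext j
        have := hβ j
        simp at this
        omega
    split_ifs with h
    · rw [hβμ.2 h] at hlead
      simpa [hβμ.2 h] using hlead.2
    · by_contra hc
      exact h (hβμ.1 (hdom.antisymm (hlead.1 _ hc)))

theorem hasLead_schurInt {n : ℕ} (μ : Fin n → ℕ) (hμ : Antitone μ) :
    HasLead (schurInt n μ) (expo μ) 1 := by
  rw [schurInt_eq_det_hFromInt, Matrix.det_apply']
  simp only [Matrix.of_apply]
  constructor
  · intro d hd
    rw [coeff_sum] at hd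
    obtain ⟨σ, _, hσ⟩ := Finset.exists_ne_zero_of_sum_ne_zero hd
    have : (((Equiv.Perm.sign σ : ℤˣ) : ℤ) : MvPolynomial (Fin n) ℤ) = C ((Equiv.Perm.sign σ : ℤˣ) : ℤ) := by
      simp
    rw [this, coeff_C_mul] at hσ
    exact (coeff_schurInt_perm μ hμ σ).1 d (right_ne_zero_of_mul hσ)
  · rw [coeff_sum, Finset.sum_eq_single 1]
    · simpa using (coeff_schurInt_perm μ hμ 1).2
    · intro σ _ hσ
      have : (((Equiv.Perm.sign σ : ℤˣ) : ℤ) : MvPolynomial (Fin n) ℤ) = C ((Equiv.Perm.sign σ : ℤˣ) : ℤ) := by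
        simp
      rw [this, coeff_C_mul, (coeff_schurInt_perm μ hμ σ).2, if_neg hσ, mul_zero]
    · simp

theorem isSymmetric_hFromInt (n : ℕ) (m : ℤ) : (hFromInt n 0 m).IsSymmetric := by
  rw [hFromInt]
  split_ifs
  · rw [← hsymm_eq_hFrom]; exact hsymm_isSymmetric _ _ _
  · exact IsSymmetric.zero

theorem isSymmetric_schurInt (n : ℕ) (μ : Fin n → ℕ) : (schurInt n μ).IsSymmetric := by
  intro e
  rw [schurInt, AlgHom.map_det]
  congr 1
  ext1 i j
  exact isSymmetric_hFromInt n _ e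

/-! ### Products of elementary symmetric polynomials -/

/-- The conjugate of `κ`: the number of entries exceeding `c`. -/
def conj {n : ℕ} (κ : Fin n → ℕ) (c : ℕ) : ℕ := (Finset.univ.filter fun i => c < κ i).card

theorem conj_le {n : ℕ} (κ : Fin n → ℕ) (c : ℕ) : conj κ c ≤ n :=
  (Finset.card_le_univ _).trans_eq (Fintype.card_fin n)

theorem card_filter_val_lt {n m : ℕ} (h : m ≤ n) :
    (Finset.univ.filter fun i : Fin n => (i : ℕ) < m).card = m := by
  rw [Fin.card_filter_val_lt, min_eq_right h]

theorem lt_conj_iff {n : ℕ} {κ : Fin n → ℕ} (hκ : Antitone κ) (i : Fin n) (c : ℕ) :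
    (i : ℕ) < conj κ c ↔ c < κ i := by
  constructor
  · intro h
    by_contra hc
    have hsub : (Finset.univ.filter fun i => c < κ i) ⊆
        Finset.univ.filter fun j : Fin n => (j : ℕ) < i := by
      intro j hj
      simp only [Finset.mem_filter, Finset.mem_univ, true_and] at hj ⊢
      by_contra hji
      have := hκ (show i ≤ j from not_lt.1 hji)
      omega
    have := Finset.card_le_card hsub
    rw [card_filter_val_lt i.2.le] at this
    exact absurd h (not_lt.2 this)
  · intro h
    have hsub : (Finset.univ.filter fun j : Fin n => (j : ℕ) < i + 1) ⊆
        Finset.univ.filter fun i => c < κ i := by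
      intro j hj
      simp only [Finset.mem_filter, Finset.mem_univ, true_and] at hj ⊢
      exact h.trans_le (hκ (show j ≤ i from Nat.lt_succ_iff.1 hj))
    have := Finset.card_le_card hsub
    rw [card_filter_val_lt (by omega)] at this
    exact this

theorem hasLead_esymm {n m : ℕ} (hm : m ≤ n) :
    HasLead (esymm (Fin n) ℤ m) (expo fun i => if (i : ℕ) < m then 1 else 0) 1 := by
  have hind (t : Finset (Fin n)) (i : Fin n) :
      (∑ j ∈ t, Finsupp.single j 1 : Fin n →₀ ℕ) i = if i ∈ t then 1 else 0 := by
    simp [Finsupp.finsetSum_apply, Finsupp.single_apply]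
  rw [esymm_eq_sum_monomial]
  constructor
  · intro d hd
    rw [coeff_sum] at hd
    obtain ⟨t, ht, hne⟩ := Finset.exists_ne_zero_of_sum_ne_zero hd
    rw [coeff_monomial, ite_ne_right_iff] at hne
    rw [Finset.mem_powersetCard] at ht
    obtain ⟨rfl, -⟩ := hne
    constructor
    · intro r
      simp only [prefixSum, hind, Finsupp.equivFunOnFinite_symm_apply_apply, ← ite_and]
      rw [← Finset.card_filter, ← Finset.card_filter]
      have e : (Finset.univ.filter fun i : Fin n => (i : ℕ) < r ∧ (i : ℕ) < m) =
          Finset.univ.filter fun i : Fin n => (i : ℕ) < min r m := by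
        ext; simp
      rw [e, Fin.card_filter_val_lt, ← min_assoc, min_comm, le_min_iff]
      constructor
      · rw [← ht.2]
        exact Finset.card_le_card fun i hi => (Finset.mem_filter.1 hi).2.2
      · rw [← Fin.card_filter_val_lt]
        exact Finset.card_le_card fun i hi => by
          simp only [Finset.mem_filter, Finset.mem_univ, true_and] at hi ⊢
          exact hi.1
    · simp only [hind, Finsupp.equivFunOnFinite_symm_apply_apply]
      rw [← Finset.card_filter, ← Finset.card_filter, card_filter_val_lt hm, ← ht.2]
      simp
  · rw [coeff_sum, Finset.sum_eq_single (Finset.univ.filter fun i : Fin n => (i : ℕ) < m)]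
    · rw [coeff_monomial, if_pos]
      ext i
      simp [hind]
    · intro t _ hne
      rw [coeff_monomial, if_neg]
      intro h
      apply hne
      ext i
      have := DFunLike.congr_fun h i
      rw [hind] at this
      simp only [Finsupp.equivFunOnFinite_symm_apply_apply] at this
      simp only [Finset.mem_filter, Finset.mem_univ, true_and]
      by_cases h1 : i ∈ t <;> by_cases h2 : (i : ℕ) < m <;> simp_all
    · intro h
      exact absurd (Finset.mem_powersetCard.2 ⟨Finset.subset_univ _, card_filter_val_lt hm⟩) h

/-- The product of the elementary symmetric polynomials of the column lengths of `κ`. -/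
noncomputable def esymmCols (n p : ℕ) (κ : Fin n → ℕ) : MvPolynomial (Fin n) ℤ :=
  ∏ c : Fin p, esymm (Fin n) ℤ (conj κ c)

theorem le_of_sum_eq {n p : ℕ} {κ : Fin n → ℕ} (h : ∑ i, κ i = p) (i : Fin n) : κ i ≤ p :=
  h ▸ Finset.single_le_sum (fun _ _ => Nat.zero_le _) (Finset.mem_univ i)

theorem hasLead_esymmCols {n p : ℕ} (κ : Fin n → ℕ) (hκ : Antitone κ) (hp : ∑ i, κ i = p) :
    HasLead (esymmCols n p κ) (expo κ) 1 := by
  have h := HasLead.prod Finset.univ (fun c : Fin p => esymm (Fin n) ℤ (conj κ c))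
    (fun c => expo fun i => if (i : ℕ) < conj κ c then 1 else 0)
    fun c _ => hasLead_esymm (conj_le κ c)
  have hsum : expo κ = ∑ c : Fin p, expo fun i : Fin n => if (i : ℕ) < conj κ c then 1 else 0 := ?_
  · rw [hsum]; exact h
  ext i
  simp only [Finsupp.equivFunOnFinite_symm_apply_apply, Finsupp.finsetSum_apply, lt_conj_iff hκ]
  rw [← Finset.card_filter, card_filter_val_lt (le_of_sum_eq hp i)]

theorem isSymmetric_esymmCols (n p : ℕ) (κ : Fin n → ℕ) : (esymmCols n p κ).IsSymmetric := by
  intro e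
  rw [esymmCols, map_prod]
  exact Finset.prod_congr rfl fun c _ => esymm_isSymmetric _ _ _ e

/-! ### Expansion of symmetric polynomials in a unitriangular family -/

open Classical in
/-- The partitions of `p` with at most `n` parts. -/
noncomputable def parts (n p : ℕ) : Finset (Fin n → ℕ) :=
  (Fintype.piFinset fun _ => Finset.range (p + 1)).filter fun κ => Antitone κ ∧ ∑ i, κ i = p

theorem mem_parts {n p : ℕ} {κ : Fin n → ℕ} : κ ∈ parts n p ↔ Antitone κ ∧ ∑ i, κ i = p := by
  simp only [parts, Finset.mem_filter, Fintype.mem_piFinset, Finset.mem_range,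
    and_iff_right_iff_imp]
  exact fun h i => Nat.lt_succ_iff.2 (le_of_sum_eq h.2 i)

/-- The sum of all prefix sums, a strictly monotone statistic for dominance. -/
def rankSum {n : ℕ} (d : Fin n → ℕ) : ℕ := ∑ r ∈ Finset.range (n + 1), prefixSum d r

theorem Dominated.eq_of_rankSum_le {n : ℕ} {d e : Fin n → ℕ} (h : Dominated d e)
    (hr : rankSum e ≤ rankSum d) : d = e := by
  have heq : ∀ r ∈ Finset.range (n + 1), prefixSum d r = prefixSum e r :=
    (Finset.sum_eq_sum_iff_of_le fun r _ => h.1 r).1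
      (le_antisymm (Finset.sum_le_sum fun r _ => h.1 r) hr)
  funext i
  have h1 := prefixSum_succ d i
  rw [heq i (by simp), heq (i + 1) (by simp), prefixSum_succ] at h1
  omega

theorem Dominated.rankSum_le {n : ℕ} {d e : Fin n → ℕ} (h : Dominated d e) :
    rankSum d ≤ rankSum e := Finset.sum_le_sum fun r _ => h.1 r

theorem coeff_perm_of_isSymmetric {n : ℕ} {g : MvPolynomial (Fin n) ℤ} (hg : g.IsSymmetric)
    (d : Fin n → ℕ) (σ : Equiv.Perm (Fin n)) : coeff (expo (d ∘ σ)) g = coeff (expo d) g := by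
  have h := coeff_rename_mapDomain (σ : Fin n → Fin n) σ.injective g (expo (d ∘ σ))
  rw [hg σ] at h
  rw [← h]
  congr 1
  ext i
  rw [← Finsupp.equivMapDomain_eq_mapDomain]
  simp

theorem eq_zero_of_coeff_antitone {n : ℕ} {g : MvPolynomial (Fin n) ℤ} (hg : g.IsSymmetric)
    (h : ∀ d : Fin n → ℕ, Antitone d → coeff (expo d) g = 0) : g = 0 := by
  ext d
  have hanti : Antitone ((d : Fin n → ℕ) ∘ (Tuple.sort d * Fin.revPerm : Equiv.Perm (Fin n))) := by
    intro i j hij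
    exact Tuple.monotone_sort d (Fin.rev_le_rev.2 hij)
  have := h _ hanti
  rw [coeff_perm_of_isSymmetric hg] at this
  simpa using this

theorem exists_expansion {n p : ℕ} (q : (Fin n → ℕ) → MvPolynomial (Fin n) ℤ)
    (hq : ∀ κ ∈ parts n p, (q κ).IsSymmetric ∧ HasLead (q κ) (expo κ) 1)
    (D : (Fin n → ℕ) → Prop) (hD : ∀ d e, Dominated d e → D e → D d)
    (g : MvPolynomial (Fin n) ℤ) (hg : g.IsSymmetric)
    (hsupp : ∀ d, Antitone d → coeff (expo d) g ≠ 0 → ∑ i, d i = p ∧ D d) :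
    ∃ b : (Fin n → ℕ) → ℤ, g = ∑ κ ∈ parts n p, C (b κ) * q κ ∧ ∀ κ, b κ ≠ 0 → D κ := by
  classical
  obtain ⟨N, hN⟩ : ∃ N, ∀ d ∈ parts n p, coeff (expo d) g ≠ 0 → rankSum d < N :=
    ⟨(parts n p).sup rankSum + 1, fun d hd _ => Nat.lt_succ_iff.2 (Finset.le_sup hd)⟩
  induction N generalizing g with
  | zero =>
    refine ⟨0, ?_, by simp⟩
    have : g = 0 := eq_zero_of_coeff_antitone hg fun d hd => by
      by_contra hc
      exact Nat.not_lt_zero _ (hN d (mem_parts.2 ⟨hd, (hsupp d hd hc).1⟩) hc)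
    simp [this]
  | succ N ih =>
    let b₀ : (Fin n → ℕ) → ℤ := fun κ =>
      if κ ∈ parts n p ∧ rankSum κ = N then coeff (expo κ) g else 0
    have hb₀ : ∀ κ, b₀ κ ≠ 0 → κ ∈ parts n p ∧ rankSum κ = N ∧ D κ := by
      intro κ h
      simp only [b₀, ite_ne_right_iff] at h
      exact ⟨h.1.1, h.1.2, (hsupp κ (mem_parts.1 h.1.1).1 h.2).2⟩
    let g' := g - ∑ κ ∈ parts n p, C (b₀ κ) * q κ
    have hg' : g'.IsSymmetric := by
      refine hg.sub (fun e => ?_)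
      rw [map_sum]
      refine Finset.sum_congr rfl fun κ hκ => ?_
      rw [map_mul, (hq κ hκ).1 e, algHom_C]
      rfl
    have hterm : ∀ d κ, κ ∈ parts n p → b₀ κ * coeff (expo d) (q κ) ≠ 0 →
        rankSum κ = N ∧ D κ ∧ Dominated d κ := fun d κ hκ h =>
      ⟨(hb₀ κ (left_ne_zero_of_mul h)).2.1, (hb₀ κ (left_ne_zero_of_mul h)).2.2,
        (hq κ hκ).2.1 _ (right_ne_zero_of_mul h)⟩
    have hcoeff : ∀ d, coeff (expo d) g' =
        coeff (expo d) g - ∑ κ ∈ parts n p, b₀ κ * coeff (expo d) (q κ) := by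
      intro d
      simp only [g', coeff_sub, coeff_sum, coeff_C_mul]
    have hsupp' : ∀ d, Antitone d → coeff (expo d) g' ≠ 0 → ∑ i, d i = p ∧ D d := by
      intro d hd hne
      by_cases h0 : coeff (expo d) g = 0
      · rw [hcoeff, h0, zero_sub, neg_ne_zero] at hne
        obtain ⟨κ, hκ, hκne⟩ := Finset.exists_ne_zero_of_sum_ne_zero hne
        obtain ⟨_, h2, h3⟩ := hterm d κ hκ hκne
        exact ⟨h3.2.trans (mem_parts.1 hκ).2, hD _ _ h3 h2⟩
      · exact hsupp d hd h0
    have hN' : ∀ d ∈ parts n p, coeff (expo d) g' ≠ 0 → rankSum d < N := by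
      intro d hd hne
      by_contra hlt
      push Not at hlt
      apply hne
      rw [hcoeff, sub_eq_zero]
      by_cases hdN : rankSum d = N
      · rw [Finset.sum_eq_single d]
        · rw [(hq d hd).2.2]; simp [b₀, hd, hdN]
        · intro κ hκ hκd
          by_contra hc
          obtain ⟨h1, _, h3⟩ := hterm d κ hκ hc
          exact hκd (h3.eq_of_rankSum_le (by omega)).symm
        · exact fun h => absurd hd h
      · have h0 : coeff (expo d) g = 0 := by
          by_contra hc
          have := hN d hd hc
          omega
        rw [h0, eq_comm]
        refine Finset.sum_eq_zero fun κ hκ => ?_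
        by_contra hc
        obtain ⟨h1, _, h3⟩ := hterm d κ hκ hc
        have := h3.rankSum_le
        omega
    obtain ⟨b, hb, hbD⟩ := ih g' hg' hsupp' hN'
    refine ⟨b₀ + b, ?_, fun κ h => ?_⟩
    · simp only [Pi.add_apply, map_add, add_mul, Finset.sum_add_distrib]
      rw [← hb]
      simp [g']
    · by_cases h0 : b₀ κ = 0
      · exact hbD κ (by simpa [h0] using h)
      · exact (hb₀ κ h0).2.2

/-! ### Triangularization -/

theorem exists_triangularization (n : ℕ) (A : Matrix (Fin n) (Fin n) ℂ) :
    ∃ g h T : Matrix (Fin n) (Fin n) ℂ, h * g = 1 ∧ g * h = 1 ∧ A = g * T * h ∧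
      ∀ i j, j < i → T i j = 0 := by
  induction n with
  | zero => exact ⟨1, 1, A, by simp, by simp, by simp, fun i => i.elim0⟩
  | succ n ih =>
    obtain ⟨μ, hμ⟩ := Module.End.exists_eigenvalue (Matrix.toLin' A)
    obtain ⟨v, hv⟩ := hμ.exists_hasEigenvector
    have hAv : A.mulVec v = μ • v := by simpa using hv.apply_eq_smul
    obtain ⟨e, he⟩ := SeparatingDual.exists_continuousLinearEquiv_apply_eq (R := ℂ)
      (x := (Pi.single 0 1 : Fin (n + 1) → ℂ)) (y := v) (by simp) hv.2
    let g₁ := LinearMap.toMatrix' (e.toLinearEquiv : (Fin (n + 1) → ℂ) →ₗ[ℂ] (Fin (n + 1) → ℂ))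
    let h₁ := LinearMap.toMatrix' (e.symm.toLinearEquiv : (Fin (n + 1) → ℂ) →ₗ[ℂ] (Fin (n + 1) → ℂ))
    have hhg : h₁ * g₁ = 1 := by
      rw [← LinearMap.toMatrix'_comp, ← LinearMap.toMatrix'_id]
      congr 1
      ext; simp
    have hgh : g₁ * h₁ = 1 := mul_eq_one_comm.1 hhg
    have hg₁ : g₁.mulVec (Pi.single 0 1) = v := by
      rw [← he]; exact LinearMap.toMatrix'_mulVec _ _
    let B := h₁ * A * g₁
    have hB0 : ∀ i : Fin n, B i.succ 0 = 0 := by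
      intro i
      have h1 : B.mulVec (Pi.single 0 1) = μ • Pi.single 0 1 := by
        simp only [B, ← Matrix.mulVec_mulVec, hg₁, hAv, Matrix.mulVec_smul]
        rw [← hg₁, Matrix.mulVec_mulVec, hhg, Matrix.one_mulVec]
      have h2 := congrFun h1 i.succ
      simpa using h2
    obtain ⟨g', h', T', hhg', hgh', hA', hT'⟩ := ih (Matrix.of fun i j => B i.succ j.succ)
    let ext1 : Matrix (Fin n) (Fin n) ℂ → Matrix (Fin (n + 1)) (Fin (n + 1)) ℂ := fun M =>
      Matrix.of (Fin.cons (Fin.cons 1 0) fun i => Fin.cons 0 (M i))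
    have hext : ∀ M N, M * N = 1 → ext1 M * ext1 N = 1 := by
      intro M N hMN
      ext i j
      have hMN' := fun i j => congrFun (congrFun hMN i) j
      simp only [Matrix.mul_apply, Matrix.one_apply] at hMN'
      refine Fin.cases ?_ (fun i => ?_) i <;> refine Fin.cases ?_ (fun j => ?_) j <;>
        simp [ext1, Matrix.mul_apply, Fin.sum_univ_succ, Matrix.one_apply, hMN', Fin.succ_ne_zero,
          (Fin.succ_ne_zero _).symm]
    refine ⟨g₁ * ext1 g', ext1 h' * h₁, ext1 h' * B * ext1 g', ?_, ?_, ?_, ?_⟩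
    · rw [mul_assoc, ← mul_assoc h₁, hhg, one_mul, hext _ _ hhg']
    · rw [mul_assoc, ← mul_assoc (ext1 g'), hext _ _ hgh', one_mul, hgh]
    · have : g₁ * ext1 g' * (ext1 h' * B * ext1 g') * (ext1 h' * h₁) =
          g₁ * (ext1 g' * ext1 h') * B * (ext1 g' * ext1 h') * h₁ := by simp only [mul_assoc]
      rw [this, hext _ _ hgh', mul_one, mul_one]
      simp only [B]
      rw [← mul_assoc, ← mul_assoc, hgh, one_mul, mul_assoc, hgh, mul_one]
    · intro i j
      have hT : T' = h' * (Matrix.of fun i j => B i.succ j.succ) * g' := by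
        rw [hA', ← mul_assoc, ← mul_assoc, hhg', one_mul, mul_assoc, hhg', mul_one]
      refine Fin.cases (fun h => absurd h (Fin.not_lt_zero _)) (fun i => ?_) i
      refine Fin.cases (fun _ => ?_) (fun j hij => ?_) j
      · simp [ext1, Matrix.mul_apply, Fin.sum_univ_succ, hB0]
      · have := hT' i j (Fin.succ_lt_succ_iff.1 hij)
        rw [hT] at this
        rw [← this]
        simp [ext1, Matrix.mul_apply, Fin.sum_univ_succ]

/-- The eigenvalues of `A`, as the diagonal of a triangularization. -/
noncomputable def eig {n : ℕ} (A : Matrix (Fin n) (Fin n) ℂ) (i : Fin n) : ℂ :=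
  (exists_triangularization n A).choose_spec.choose_spec.choose i i

theorem exists_eig {n : ℕ} (A : Matrix (Fin n) (Fin n) ℂ) :
    ∃ g h T : Matrix (Fin n) (Fin n) ℂ, h * g = 1 ∧ g * h = 1 ∧ A = g * T * h ∧
      (∀ i j, j < i → T i j = 0) ∧ ∀ i, eig A i = T i i :=
  let H := (exists_triangularization n A).choose_spec.choose_spec.choose_spec
  ⟨_, _, _, H.1, H.2.1, H.2.2.1, H.2.2.2, fun _ => rfl⟩

/-! ### Cyclic contractions of matrices -/

theorem comp_eq_of_le {n : ℕ} {ι : Type*} [Fintype ι] (σ : Equiv.Perm ι) (J : ι → Fin n) (h : ∀ i, J i ≤ J (σ i)) :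
    J ∘ σ = J := by
  have h1 : ∑ i, (J i : ℕ) = ∑ i, (J (σ i) : ℕ) := (Equiv.sum_comp σ fun i => (J i : ℕ)).symm
  have h2 := (Finset.sum_eq_sum_iff_of_le (f := fun i => (J i : ℕ))
    (g := fun i => (J (σ i) : ℕ)) fun i _ => h i).1 h1
  funext i
  exact (Fin.ext (h2 i (Finset.mem_univ i))).symm

section Contraction

variable {n : ℕ} {ι : Type*} [Fintype ι] [DecidableEq ι]

theorem prod_sum_pi {R β : Type*} [CommSemiring R] [Fintype β] (f : ι → β → R) :
    ∏ i, ∑ k, f i k = ∑ K : ι → β, ∏ i, f i (K i) := by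
  rw [Finset.prod_univ_sum, Fintype.piFinset_univ]

/-- Contraction of a family of matrices along a permutation. -/
def contract {R : Type*} [CommRing R] (σ : Equiv.Perm ι) (M : ι → Matrix (Fin n) (Fin n) R) : R :=
  ∑ J : ι → Fin n, ∏ i, M i (J i) (J (σ i))

theorem contract_mul_comm {R : Type*} [CommRing R] (σ : Equiv.Perm ι)
    (X Y : ι → Matrix (Fin n) (Fin n) R) :
    contract σ (fun i => X i * Y i) = contract σ (fun i => Y i * X (σ i)) := by
  simp only [contract, Matrix.mul_apply, prod_sum_pi]
  rw [Finset.sum_comm]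
  refine Finset.sum_congr rfl fun K _ => ?_
  refine Fintype.sum_equiv (Equiv.arrowCongr σ.symm (Equiv.refl _)) _ _ fun J => ?_
  simp only [Finset.prod_mul_distrib, Equiv.arrowCongr_apply, Equiv.symm_symm, Equiv.coe_refl,
    Function.comp_apply, id_eq]
  rw [mul_comm]
  congr 1
  exact (Equiv.prod_comp σ fun i => X i (J i) (K i)).symm

/-- The sum over colourings fixed by `σ` of the product of the colours over `S`. -/
noncomputable def fixPoly (n : ℕ) (S : Finset ι) (σ : Equiv.Perm ι) : MvPolynomial (Fin n) ℤ :=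
  ∑ J : ι → Fin n, if J ∘ σ = J then ∏ i ∈ S, X (J i) else 0

theorem aeval_eig_fixPoly (S : Finset ι) (σ : Equiv.Perm ι) (A : Matrix (Fin n) (Fin n) ℂ) :
    aeval (eig A) (fixPoly n S σ) =
      ∑ J : ι → Fin n, if ∀ i ∉ S, J i = J (σ i) then ∏ i ∈ S, A (J i) (J (σ i)) else 0 := by
  obtain ⟨g, h, T, hhg, hgh, hA, hT, heig⟩ := exists_eig A
  have key (M : Matrix (Fin n) (Fin n) ℂ) (J : ι → Fin n) :
      ∏ i, (if i ∈ S then M else 1) (J i) (J (σ i)) =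
        if ∀ i ∉ S, J i = J (σ i) then ∏ i ∈ S, M (J i) (J (σ i)) else 0 := by
    have e (i : ι) : (if i ∈ S then M else 1) (J i) (J (σ i)) =
        (if i ∈ S then M (J i) (J (σ i)) else 1) *
          (if i ∉ S then (if J i = J (σ i) then (1 : ℂ) else 0) else 1) := by
      by_cases hi : i ∈ S <;> simp [hi, Matrix.one_apply]
    simp only [e, Finset.prod_mul_distrib]
    rw [Finset.prod_ite_mem, Finset.univ_inter, ← Finset.prod_filter, Finset.prod_boole]
    simp
  have hconj : contract σ (fun i => if i ∈ S then A else 1) =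
      contract σ (fun i => if i ∈ S then T else 1) := by
    have e1 : (fun i => if i ∈ S then A else 1) =
        fun i => g * ((if i ∈ S then T else 1) * h) := by
      funext i
      split_ifs
      · rw [hA, mul_assoc]
      · rw [one_mul]; exact hgh.symm
    rw [e1, contract_mul_comm]
    simp only [mul_assoc, hhg, mul_one]
  have e2 : ∑ J : ι → Fin n, (if ∀ i ∉ S, J i = J (σ i) then ∏ i ∈ S, A (J i) (J (σ i)) else 0) =
      contract σ (fun i => if i ∈ S then A else 1) := by
    simp only [contract, key]
  rw [e2, hconj, contract, fixPoly, map_sum]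
  refine Finset.sum_congr rfl fun J _ => ?_
  by_cases hJ : J ∘ σ = J
  · have hJ' : ∀ i, J (σ i) = J i := fun i => congrFun hJ i
    rw [key]
    simp only [hJ, hJ', if_true, map_prod, aeval_X, implies_true, heig]
  · rw [if_neg hJ, map_zero, eq_comm]
    have : ∃ i, J (σ i) < J i := by
      by_contra hc
      push Not at hc
      exact hJ (comp_eq_of_le σ J hc)
    obtain ⟨i, hi⟩ := this
    refine Finset.prod_eq_zero (Finset.mem_univ i) ?_
    split_ifs
    · exact hT _ _ hi
    · exact Matrix.one_apply_ne hi.ne'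

end Contraction

/-! ### The functional -/

section Functional

variable {n : ℕ} {ι B : Type*} [Fintype ι] [DecidableEq ι] [Fintype B] [DecidableEq B]

theorem sum_neg_one_pow_prod_sum {P : Type*} [Fintype P] [DecidableEq P]
    (hcard : Fintype.card P = Fintype.card B) (c : P → B → ℂ) :
    ∑ U : Finset B, (-1 : ℂ) ^ U.card * ∏ i, ∑ t ∈ Uᶜ, c i t =
      ∑ θ : P ≃ B, ∏ i, c i (θ i) := by
  have h1 (U : Finset B) : ∏ i, ∑ t ∈ Uᶜ, c i t =
      ∑ θ : P → B, if U ⊆ (Finset.univ.image θ)ᶜ then ∏ i, c i (θ i) else 0 := by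
    have e (i : P) : ∑ t ∈ Uᶜ, c i t = ∑ t, if t ∈ Uᶜ then c i t else 0 := by
      rw [Finset.sum_ite_mem, Finset.univ_inter]
    simp only [e, prod_sum_pi]
    refine Finset.sum_congr rfl fun θ _ => ?_
    split_ifs with h
    · refine Finset.prod_congr rfl fun i _ => if_pos ?_
      rw [Finset.mem_compl]
      intro hi
      have := h hi
      simp at this
    · obtain ⟨t, ht, ht'⟩ := Finset.not_subset.1 h
      simp only [Finset.mem_compl, Finset.mem_image, Finset.mem_univ, true_and, not_not] at ht'
      obtain ⟨i, rfl⟩ := ht'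
      exact Finset.prod_eq_zero (Finset.mem_univ i) (by simp [ht])
  simp only [h1, Finset.mul_sum]
  rw [Finset.sum_comm]
  have h2 (θ : P → B) : ∑ U : Finset B, (-1 : ℂ) ^ U.card *
      (if U ⊆ (Finset.univ.image θ)ᶜ then ∏ i, c i (θ i) else 0) =
      if Function.Bijective θ then ∏ i, c i (θ i) else 0 := by
    simp only [mul_ite, mul_zero]
    rw [← Finset.sum_filter, ← Finset.sum_mul]
    have e : (Finset.univ.filter fun U : Finset B => U ⊆ (Finset.univ.image θ)ᶜ) =
        ((Finset.univ.image θ)ᶜ).powerset := by ext; simp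
    have e2 := Finset.sum_powerset_neg_one_pow_card (x := (Finset.univ.image θ)ᶜ)
    have e3 : ∑ U ∈ ((Finset.univ.image θ)ᶜ).powerset, (-1 : ℂ) ^ U.card =
        if (Finset.univ.image θ)ᶜ = ∅ then 1 else 0 := by
      rw [← Int.cast_one, ← Int.cast_zero (R := ℂ), ← Int.cast_ite, ← e2]
      push_cast
      rfl
    rw [e, e3]
    have e4 : (Finset.univ.image θ)ᶜ = ∅ ↔ Function.Bijective θ := by
      rw [Finset.compl_eq_empty_iff, Fintype.bijective_iff_surjective_and_card,
        Finset.eq_univ_iff_forall]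
      simp [hcard, Function.Surjective]
    simp only [e4, ite_mul, one_mul, zero_mul]
  simp only [h2]
  rw [← Finset.sum_filter]
  refine (Finset.sum_bij (fun (θ : P ≃ B) _ => (θ : P → B)) (fun θ _ => ?_) (fun θ _ θ' _ h => ?_)
    (fun θ hθ => ?_) fun _ _ => ?_).symm
  · simp
  · exact DFunLike.coe_injective h
  · exact ⟨Equiv.ofBijective θ (Finset.mem_filter.1 hθ).2, Finset.mem_univ _, rfl⟩
  · rfl

/-- The linear functional attached to an integer weight `w` on colourings of `B`. -/
noncomputable def functional (w : (B → Fin n) → ℤ) : MvPolynomial (Fin n) ℤ →ₗ[ℤ] ℂ :=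
  ∑ a : B → Fin n, ∑ b : B → Fin n, ∑ U : Finset B, (w a * w b * (-1) ^ U.card) •
    (aeval (R := ℤ) (eig (∑ t ∈ Uᶜ, Matrix.single (a t) (b t) (1 : ℂ)))).toLinearMap

/-- The contribution of the matching `θ` to the value of the functional on `fixPoly n S σ`. -/
def pairing (w : (B → Fin n) → ℤ) (S : Finset ι) (θ : S ≃ B) (σ : Equiv.Perm ι) : ℤ :=
  ∑ J : ι → Fin n, if ∀ i ∉ S, J i = J (σ i) then
    w (fun t => J (θ.symm t)) * w (fun t => J (σ (θ.symm t))) else 0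

theorem functional_fixPoly (w : (B → Fin n) → ℤ) (S : Finset ι) (hS : S.card = Fintype.card B)
    (σ : Equiv.Perm ι) :
    functional w (fixPoly n S σ) = ((∑ θ : S ≃ B, pairing w S θ σ : ℤ) : ℂ) := by
  have h1 (a b : B → Fin n) : ∑ U : Finset B, (-1 : ℂ) ^ U.card *
      aeval (eig (∑ t ∈ Uᶜ, Matrix.single (a t) (b t) (1 : ℂ))) (fixPoly n S σ) =
      ∑ θ : S ≃ B, ∑ J : ι → Fin n, if ∀ i ∉ S, J i = J (σ i) then
        (if a = (fun t => J (θ.symm t)) then 1 else 0) *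
          (if b = (fun t => J (σ (θ.symm t))) then 1 else 0) else 0 := by
    simp only [aeval_eig_fixPoly, Finset.mul_sum]
    rw [Finset.sum_comm, Finset.sum_comm (s := (Finset.univ : Finset (S ≃ B)))]
    refine Finset.sum_congr rfl fun J _ => ?_
    split_ifs with hJ
    · have e (U : Finset B) : ∏ i ∈ S, (∑ t ∈ Uᶜ, Matrix.single (a t) (b t) (1 : ℂ)) (J i) (J (σ i))
          = ∏ i : S, ∑ t ∈ Uᶜ, if a t = J i ∧ b t = J (σ i) then (1 : ℂ) else 0 := by
        rw [← Finset.prod_coe_sort]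
        refine Finset.prod_congr rfl fun i _ => ?_
        rw [Matrix.sum_apply]
        simp [Matrix.single_apply]
      simp only [e]
      rw [sum_neg_one_pow_prod_sum (by simpa using hS)]
      refine Finset.sum_congr rfl fun θ _ => ?_
      rw [Finset.prod_boole, ite_zero_mul_ite_zero, one_mul]
      congr 1
      refine propext ⟨fun h => ⟨?_, ?_⟩, ?_⟩
      · funext t
        simpa using (h (θ.symm t) (Finset.mem_univ _)).1
      · funext t
        simpa using (h (θ.symm t) (Finset.mem_univ _)).2
      · rintro ⟨rfl, rfl⟩ i _
        simp
    · simp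
  have h2 : functional w (fixPoly n S σ) = ∑ a : B → Fin n, ∑ b : B → Fin n, ((w a : ℂ) * w b) *
      ∑ U : Finset B, (-1 : ℂ) ^ U.card *
        aeval (eig (∑ t ∈ Uᶜ, Matrix.single (a t) (b t) (1 : ℂ))) (fixPoly n S σ) := by
    simp [functional, LinearMap.sum_apply, Finset.mul_sum, mul_assoc]
  rw [h2]
  simp only [h1, Finset.mul_sum, pairing]
  push_cast
  have h3 : ∀ f : (B → Fin n) → (B → Fin n) → (S ≃ B) → (ι → Fin n) → ℂ,
      ∑ a, ∑ b, ∑ θ, ∑ J, f a b θ J = ∑ θ, ∑ J, ∑ a, ∑ b, f a b θ J := by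
    intro f
    calc _ = ∑ a, ∑ θ, ∑ b, ∑ J, f a b θ J := Finset.sum_congr rfl fun _ _ => Finset.sum_comm
      _ = ∑ θ, ∑ a, ∑ b, ∑ J, f a b θ J := Finset.sum_comm
      _ = ∑ θ, ∑ a, ∑ J, ∑ b, f a b θ J :=
        Finset.sum_congr rfl fun _ _ => Finset.sum_congr rfl fun _ _ => Finset.sum_comm
      _ = _ := Finset.sum_congr rfl fun _ _ => Finset.sum_comm
  rw [h3]
  refine Finset.sum_congr rfl fun θ _ => Finset.sum_congr rfl fun J _ => ?_
  split_ifs with hJ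
  · rw [Finset.sum_eq_single fun t => J (θ.symm t), Finset.sum_eq_single fun t => J (σ (θ.symm t))]
    · simp
    · intro b _ hb; simp [hb]
    · simp
    · intro a _ ha; simp [ha]
    · simp
  · simp

end Functional

/-! ### Positivity of twisted sums over a group -/

section Positivity

variable {n : ℕ} {ι B G : Type*} [Fintype ι] [DecidableEq ι] [Group G] [Fintype G]

theorem sum_sign_mul_nonneg (Φ : G →* Equiv.Perm ι) (ε : G →* ℤˣ) (v : (ι → Fin n) → ℤ) :
    0 ≤ ∑ g, (ε g : ℤ) * ∑ J : ι → Fin n, v J * v (J ∘ Φ g) := by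
  have key : ∑ J : ι → Fin n, (∑ g, (ε g : ℤ) * v (J ∘ Φ g)) ^ 2 =
      Fintype.card G * ∑ g, (ε g : ℤ) * ∑ J : ι → Fin n, v J * v (J ∘ Φ g) := by
    have h1 (J : ι → Fin n) : (∑ g, (ε g : ℤ) * v (J ∘ Φ g)) ^ 2 =
        ∑ h, ∑ g, (ε g : ℤ) * (v (J ∘ Φ h) * v ((J ∘ Φ h) ∘ Φ g)) := by
      rw [sq, Finset.sum_mul]
      refine Finset.sum_congr rfl fun h _ => ?_
      rw [Finset.mul_sum, ← Equiv.sum_comp (Equiv.mulLeft h)]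
      refine Finset.sum_congr rfl fun g _ => ?_
      have hh : (ε h : ℤ) * ε h = 1 := by rw [← Units.val_mul, Int.units_mul_self, Units.val_one]
      simp only [Equiv.coe_mulLeft, map_mul, Units.val_mul, Equiv.Perm.coe_mul, Function.comp_assoc]
      linear_combination (ε g : ℤ) * v (J ∘ Φ h) * v (J ∘ Φ h ∘ Φ g) * hh
    simp only [h1]
    rw [Finset.sum_comm, ← Finset.card_univ, ← nsmul_eq_mul, ← Finset.sum_const]
    refine Finset.sum_congr rfl fun h _ => ?_
    rw [Finset.sum_comm]
    refine Finset.sum_congr rfl fun g _ => ?_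
    rw [Finset.mul_sum]
    exact Fintype.sum_equiv (Equiv.arrowCongr (Φ h).symm (Equiv.refl (Fin n))) _ _ fun J => rfl
  have hpos : (0 : ℤ) < Fintype.card G := by exact_mod_cast Fintype.card_pos
  refine nonneg_of_mul_nonneg_right ?_ hpos
  rw [← key]
  exact Finset.sum_nonneg fun J _ => sq_nonneg _

theorem sum_sign_mul_pairing_nonneg (Φ : G →* Equiv.Perm ι) (ε : G →* ℤˣ) (w : (B → Fin n) → ℤ)
    (S : Finset ι) (θ : S ≃ B) : 0 ≤ ∑ g, (ε g : ℤ) * pairing w S θ (Φ g) := by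
  let v (u : {i // i ∉ S} → Fin n) (J : ι → Fin n) : ℤ :=
    if ∀ i : {i // i ∉ S}, J i = u i then w (fun t => J (θ.symm t)) else 0
  have h (σ : Equiv.Perm ι) :
      pairing w S θ σ = ∑ u, ∑ J : ι → Fin n, v u J * v u (J ∘ σ) := by
    rw [Finset.sum_comm]
    refine Finset.sum_congr rfl fun J _ => ?_
    rw [Finset.sum_eq_single fun i : {i // i ∉ S} => J i]
    · simp only [v, implies_true, if_true, Function.comp_apply, mul_ite, mul_zero]
      congr 1
      simp [eq_comm]
    · intro u _ hu
      simp only [v]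
      rw [if_neg, zero_mul]
      exact fun h => hu (funext h).symm
    · simp
  simp only [h, Finset.mul_sum]
  rw [Finset.sum_comm]
  refine Finset.sum_nonneg fun u _ => ?_
  simpa only [Finset.mul_sum] using sum_sign_mul_nonneg Φ ε (v u)

variable [Fintype B] [DecidableEq B]

theorem functional_sum_nonneg (Φ : G →* Equiv.Perm ι) (ε : G →* ℤˣ) (w : (B → Fin n) → ℤ)
    (S : Finset ι) (hS : S.card = Fintype.card B) :
    ∃ z : ℤ, 0 ≤ z ∧ functional w (∑ g, (ε g : ℤ) • fixPoly n S (Φ g)) = z := by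
  refine ⟨∑ θ : S ≃ B, ∑ g, (ε g : ℤ) * pairing w S θ (Φ g),
    Finset.sum_nonneg fun θ _ => sum_sign_mul_pairing_nonneg Φ ε w S θ, ?_⟩
  rw [map_sum, Finset.sum_comm]
  push_cast
  refine Finset.sum_congr rfl fun g _ => ?_
  rw [map_zsmul, functional_fixPoly w S hS, zsmul_eq_mul]
  push_cast
  rw [Finset.mul_sum]

theorem functional_fixPoly_univ (w : (B → Fin n) → ℤ) (h : Fintype.card ι = Fintype.card B)
    (σ : Equiv.Perm ι) : functional w (fixPoly n Finset.univ σ) =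
      ((∑ θ : ι ≃ B, ∑ J : ι → Fin n, w (J ∘ θ.symm) * w (J ∘ σ ∘ θ.symm) : ℤ) : ℂ) := by
  rw [functional_fixPoly w _ (by simpa using h)]
  congr 1
  refine Fintype.sum_equiv ((Equiv.subtypeUnivEquiv Finset.mem_univ).equivCongr (Equiv.refl B)) _ _
    fun θ => ?_
  simp only [pairing, Finset.mem_univ, not_true_eq_false, false_imp_iff, implies_true, if_true]
  rfl

theorem functional_sum_fixPoly_univ (w : (B → Fin n) → ℤ) (h : Fintype.card ι = Fintype.card B)
    (Φ : G →* Equiv.Perm ι) (ε : G →* ℤˣ) :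
    functional w (∑ g, (ε g : ℤ) • fixPoly n Finset.univ (Φ g)) =
      ((∑ θ : ι ≃ B, ∑ J : ι → Fin n, w (J ∘ θ.symm) * ∑ g, ε g * w (J ∘ Φ g ∘ θ.symm) : ℤ) : ℂ) := by
  rw [map_sum]
  simp only [map_zsmul, functional_fixPoly_univ w h]
  simp only [zsmul_eq_mul]
  norm_cast
  simp only [Finset.mul_sum]
  rw [Finset.sum_comm]
  refine Finset.sum_congr rfl fun θ _ => ?_
  rw [Finset.sum_comm]
  exact Finset.sum_congr rfl fun J _ => Finset.sum_congr rfl fun g _ => by ring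

end Positivity

/-! ### Block permutations -/

section Blocks

variable {β : Type*} [Fintype β]

/-- The product of the signs of the block components. -/
def blockSign (α : β → ℕ) : ((b : β) → Equiv.Perm (Fin (α b))) →* ℤˣ :=
  ∏ b, Equiv.Perm.sign.comp (Pi.evalMonoidHom _ b)

theorem blockSign_apply (α : β → ℕ) (g : (b : β) → Equiv.Perm (Fin (α b))) :
    blockSign α g = ∏ b, Equiv.Perm.sign (g b) := by
  simp [blockSign, MonoidHom.finsetProd_apply]

variable [DecidableEq β]

theorem fixPoly_sigmaCongrRight (n : ℕ) (α : β → ℕ) (g : (b : β) → Equiv.Perm (Fin (α b))) :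
    fixPoly n Finset.univ (Equiv.Perm.sigmaCongrRightHom (fun b => Fin (α b)) g) =
      ∏ b, fixPoly n Finset.univ (g b) := by
  simp only [fixPoly]
  rw [Finset.prod_univ_sum, Fintype.piFinset_univ]
  refine Fintype.sum_equiv (Equiv.piCurry fun _ _ => Fin n) _ _ fun J => ?_
  have h1 : (J ∘ (Equiv.Perm.sigmaCongrRightHom (fun b => Fin (α b)) g) = J) ↔
      ∀ b, (Equiv.piCurry (fun _ _ => Fin n) J) b ∘ g b = (Equiv.piCurry (fun _ _ => Fin n) J) b := by
    constructor
    · intro h b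
      funext j
      exact congrFun h ⟨b, j⟩
    · intro h
      funext ⟨b, j⟩
      exact congrFun (h b) j
  by_cases h : J ∘ (Equiv.Perm.sigmaCongrRightHom (fun b => Fin (α b)) g) = J
  · rw [if_pos h, Fintype.prod_sigma]
    refine Finset.prod_congr rfl fun b _ => ?_
    rw [if_pos (h1.1 h b)]
    rfl
  · rw [if_neg h, eq_comm]
    obtain ⟨b, hb⟩ := not_forall.1 (mt h1.2 h)
    exact Finset.prod_eq_zero (Finset.mem_univ b) (if_neg hb)

theorem prod_sum_fixPoly (n : ℕ) (α : β → ℕ) (χ : (m : ℕ) → Equiv.Perm (Fin m) → ℤ) :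
    ∏ b, ∑ σ : Equiv.Perm (Fin (α b)), χ (α b) σ • fixPoly n Finset.univ σ =
      ∑ g : (b : β) → Equiv.Perm (Fin (α b)), (∏ b, χ (α b) (g b)) •
        fixPoly n Finset.univ (Equiv.Perm.sigmaCongrRightHom (fun b => Fin (α b)) g) := by
  rw [Finset.prod_univ_sum, Fintype.piFinset_univ]
  refine Finset.sum_congr rfl fun g _ => ?_
  rw [fixPoly_sigmaCongrRight]
  simp only [zsmul_eq_mul, Finset.prod_mul_distrib, Int.cast_prod]

end Blocks

/-! ### Stabilizer sums -/

theorem sum_sign_eq_zero {G : Type*} [Group G] [Fintype G] (ε : G →* ℤˣ) (f : G → ℤ) (t : G)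
    (ht : ε t = -1) (h : ∀ g, f (t * g) = f g) : ∑ g, (ε g : ℤ) * f g = 0 := by
  have := Equiv.sum_comp (Equiv.mulLeft t) fun g => (ε g : ℤ) * f g
  simp only [Equiv.coe_mulLeft, map_mul, ht, h, Units.val_neg,
    neg_mul, one_mul, Finset.sum_neg_distrib] at this
  omega

theorem sum_sign_eq_zero_right {G : Type*} [Group G] [Fintype G] (f : G → ℤ) (t : G)
    (h : ∀ g, f (g * t) = - f g) : ∑ g, f g = 0 := by
  have := Equiv.sum_comp (Equiv.mulRight t) f
  simp only [Equiv.coe_mulRight, h, Finset.sum_neg_distrib] at this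
  omega

theorem sum_sign_smul_fixPoly {G ι : Type*} [Group G] [Fintype G] [Fintype ι] [DecidableEq ι]
    (n : ℕ) (Φ : G →* Equiv.Perm ι) (ε : G →* ℤˣ) (S : Finset ι) (good : (ι → Fin n) → Prop)
    [DecidablePred good] (hbad : ∀ J, ¬ good J → ∃ t, J ∘ Φ t = J ∧ ε t = -1)
    (hgood : ∀ J, good J → ∀ g, J ∘ Φ g = J → g = 1) :
    ∑ g, (ε g : ℤ) • fixPoly n S (Φ g) =
      ∑ J : ι → Fin n, if good J then ∏ i ∈ S, X (J i) else 0 := by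
  simp only [fixPoly, Finset.smul_sum]
  rw [Finset.sum_comm]
  refine Finset.sum_congr rfl fun J _ => ?_
  have e : ∑ g, (ε g : ℤ) • (if J ∘ Φ g = J then ∏ i ∈ S, X (J i) else 0 : MvPolynomial (Fin n) ℤ) =
      (∑ g, (ε g : ℤ) * if J ∘ Φ g = J then 1 else 0) • ∏ i ∈ S, X (J i) := by
    rw [Finset.sum_smul]
    refine Finset.sum_congr rfl fun g _ => ?_
    split_ifs <;> simp
  rw [e]
  split_ifs with h
  · rw [Finset.sum_eq_single 1]
    · simp
    · intro g _ hg
      rw [if_neg fun hc => hg (hgood J h g hc), mul_zero]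
    · simp
  · obtain ⟨t, ht, htε⟩ := hbad J h
    rw [sum_sign_eq_zero ε _ t htε, zero_smul]
    intro g
    rw [map_mul, Equiv.Perm.coe_mul, ← Function.comp_assoc, ht]

theorem sum_injective_prod {α R : Type*} [Fintype α] [DecidableEq α] [CommRing R] (p : ℕ)
    (A : Finset α) (Y : α → R) :
    (∑ J : Fin p → α, if Function.Injective J ∧ ∀ i, J i ∈ A then ∏ i, Y (J i) else 0) =
      p.factorial • ∑ F ∈ A.powersetCard p, ∏ a ∈ F, Y a := by
  classical
  rw [← Finset.sum_filter]
  have hmaps : ∀ J ∈ Finset.univ.filter fun J : Fin p → α => Function.Injective J ∧ ∀ i, J i ∈ A,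
      Finset.univ.image J ∈ A.powersetCard p := by
    intro J hJ
    obtain ⟨h1, h2⟩ := (Finset.mem_filter.1 hJ).2
    rw [Finset.mem_powersetCard, Finset.card_image_of_injective _ h1]
    refine ⟨fun a ha => ?_, by simp⟩
    obtain ⟨i, -, rfl⟩ := Finset.mem_image.1 ha
    exact h2 i
  rw [← Finset.sum_fiberwise_of_maps_to hmaps, Finset.smul_sum]
  refine Finset.sum_congr rfl fun F hF => ?_
  rw [Finset.mem_powersetCard] at hF
  have h1 : ∀ J ∈ (Finset.univ.filter fun J : Fin p → α => Function.Injective J ∧ ∀ i, J i ∈ A).filter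
      fun J => Finset.univ.image J = F, ∏ i, Y (J i) = ∏ a ∈ F, Y a := by
    intro J hJ
    simp only [Finset.mem_filter, Finset.mem_univ, true_and] at hJ
    rw [← hJ.2, Finset.prod_image fun _ _ _ _ h => hJ.1.1 h]
  rw [Finset.sum_congr rfl h1, Finset.sum_const]
  congr 1
  have hc : Fintype.card (Fin p ≃ F) = p.factorial := by
    rw [Fintype.card_equiv (F.equivFinOfCardEq hF.2).symm, Fintype.card_fin]
  rw [← hc, ← Finset.card_univ]
  symm
  refine Finset.card_bij (fun e _ i => (e i : α)) ?_ ?_ ?_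
  · intro e _
    simp only [Finset.mem_filter, Finset.mem_univ, true_and]
    refine ⟨⟨Subtype.val_injective.comp e.injective, fun i => hF.1 (e i).2⟩, ?_⟩
    ext a
    simp only [Finset.mem_image, Finset.mem_univ, true_and]
    constructor
    · rintro ⟨i, rfl⟩; exact (e i).2
    · intro ha; exact ⟨e.symm ⟨a, ha⟩, by simp⟩
  · intro e _ e' _ h
    ext i
    exact congrFun h i
  · intro J hJ
    simp only [Finset.mem_filter, Finset.mem_univ, true_and] at hJ
    obtain ⟨⟨h1, h2⟩, h3⟩ := hJ
    have hm (i : Fin p) : J i ∈ F := h3 ▸ Finset.mem_image_of_mem _ (Finset.mem_univ i)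
    refine ⟨Equiv.ofBijective (fun i => ⟨J i, hm i⟩) ⟨fun i j h => h1 (congrArg Subtype.val h), ?_⟩,
      Finset.mem_univ _, rfl⟩
    rintro ⟨a, ha⟩
    rw [← h3] at ha
    obtain ⟨i, -, rfl⟩ := Finset.mem_image.1 ha
    exact ⟨i, rfl⟩

theorem sum_sign_smul_fixPoly_eq_esymm (n m : ℕ) :
    ∑ σ : Equiv.Perm (Fin m), (Equiv.Perm.sign σ : ℤ) • fixPoly n Finset.univ σ =
      m.factorial • esymm (Fin n) ℤ m := by
  classical
  have h := sum_sign_smul_fixPoly n (MonoidHom.id (Equiv.Perm (Fin m))) Equiv.Perm.sign Finset.univ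
    (fun J => Function.Injective J) ?_ ?_
  · refine h.trans ?_
    rw [esymm, ← sum_injective_prod]
    simp
  · intro J hJ
    simp only [Function.Injective, not_forall] at hJ
    obtain ⟨i, j, hij, hne⟩ := hJ
    refine ⟨Equiv.swap i j, ?_, Equiv.Perm.sign_swap hne⟩
    funext x
    simp only [MonoidHom.id_apply, Function.comp_apply, Equiv.swap_apply_def]
    split_ifs with h1 h2
    · rw [h1, hij]
    · rw [h2, hij]
    · rfl
  · intro J hJ g hg
    ext i
    exact congrArg Fin.val (hJ (congrFun hg i))

theorem sum_fixPoly_eq_hsymm (n m : ℕ) :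
    ∑ σ : Equiv.Perm (Fin m), fixPoly n Finset.univ σ = m.factorial • hsymm (Fin n) ℤ m := by
  classical
  let toSym (J : Fin m → Fin n) : Sym (Fin n) m := ⟨Finset.univ.val.map J, by simp⟩
  have hX (J : Fin m → Fin n) :
      (∏ i, X (J i) : MvPolynomial (Fin n) ℤ) = ((toSym J).1.map X).prod := by
    simp only [toSym, Finset.prod, Multiset.map_map, Function.comp_def]
  have hperm (J K : Fin m → Fin n) (h : toSym J = toSym K) : ∃ τ : Equiv.Perm (Fin m), K ∘ τ = J := by
    have hc (y : Fin n) : Nonempty ({i // J i = y} ≃ {i // K i = y}) := by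
      have := congrArg (fun s : Sym (Fin n) m => s.1.count y) h
      simp only [toSym, Multiset.count_map] at this
      refine Fintype.card_eq.1 ?_
      rw [Fintype.card_subtype, Fintype.card_subtype]
      simpa [Finset.card, Finset.filter, eq_comm] using this
    exact ⟨Equiv.ofFiberEquiv fun y => (hc y).some, funext fun i => Equiv.ofFiberEquiv_map _ i⟩
  have hsurj (s : Sym (Fin n) m) : ∃ J, toSym J = s := by
    obtain ⟨s, hs⟩ := s
    induction s using Quotient.inductionOn with
    | h l =>
      have hl : l.length = m := by simpa using hs
      subst hl
      refine ⟨l.get, Subtype.ext ?_⟩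
      simp [toSym]
  simp only [fixPoly]
  rw [Finset.sum_comm, hsymm, Finset.smul_sum,
    ← Finset.sum_fiberwise_of_maps_to (g := toSym) (fun _ _ => Finset.mem_univ _)]
  refine Finset.sum_congr rfl fun s _ => ?_
  obtain ⟨K, rfl⟩ := hsurj s
  have h1 (J : Fin m → Fin n) (hJ : J ∈ Finset.univ.filter fun J => toSym J = toSym K) :
      ∑ σ : Equiv.Perm (Fin m), (if J ∘ σ = J then ∏ i, X (J i) else 0 : MvPolynomial (Fin n) ℤ) =
      ∑ τ : Equiv.Perm (Fin m), if K ∘ τ = J then ((toSym K).1.map X).prod else 0 := by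
    have hJ' := (Finset.mem_filter.1 hJ).2
    obtain ⟨τ, hτ⟩ := hperm J K hJ'
    rw [hX, hJ']
    conv_rhs => rw [← Equiv.sum_comp (Equiv.mulLeft τ)]
    refine Finset.sum_congr rfl fun σ _ => ?_
    simp only [Equiv.coe_mulLeft, Equiv.Perm.coe_mul, ← Function.comp_assoc, hτ]
  rw [Finset.sum_congr rfl h1, Finset.sum_comm]
  have h2 (τ : Equiv.Perm (Fin m)) : ∑ J ∈ Finset.univ.filter (fun J => toSym J = toSym K),
      (if K ∘ τ = J then ((toSym K).1.map X).prod else 0 : MvPolynomial (Fin n) ℤ) =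
        ((toSym K).1.map X).prod := by
    rw [Finset.sum_ite_eq, if_pos]
    simp only [Finset.mem_filter, Finset.mem_univ, true_and, toSym]
    refine Subtype.ext ?_
    simp only
    rw [← Multiset.map_map]
    congr 1
    have := Finset.map_univ_equiv τ
    exact congrArg Finset.val this
  simp only [h2, Finset.sum_const, Finset.card_univ, Fintype.card_perm, Fintype.card_fin]

/-! ### The antisymmetrized filling of a diagram -/

/-- Permutations preserving the blocks, acting on the disjoint union of the blocks. -/
abbrev blockAct {β : Type*} (α : β → ℕ) :
    ((b : β) → Equiv.Perm (Fin (α b))) →* Equiv.Perm (Σ b, Fin (α b)) :=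
  Equiv.Perm.sigmaCongrRightHom fun b => Fin (α b)

theorem blockAct_apply {β : Type*} (α : β → ℕ) (g : (b : β) → Equiv.Perm (Fin (α b)))
    (x : Σ b, Fin (α b)) : blockAct α g x = ⟨x.1, g x.1 x.2⟩ := rfl

theorem exists_blockAct_eq_swap {β : Type*} [Fintype β] [DecidableEq β] {α : β → ℕ}
    {x y : Σ b, Fin (α b)} (hxy : x ≠ y) (h : x.1 = y.1) :
    ∃ t, blockAct α t = Equiv.swap x y ∧ blockSign α t = -1 := by
  obtain ⟨b, i⟩ := x
  obtain ⟨b', j⟩ := y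
  obtain rfl : b = b' := h
  have hij : i ≠ j := fun h => hxy (by rw [h])
  refine ⟨Pi.mulSingle b (Equiv.swap i j), ?_, ?_⟩
  · ext1 ⟨c, k⟩
    rw [blockAct_apply]
    by_cases hc : c = b
    · subst hc
      simp only [Pi.mulSingle_eq_same, Equiv.swap_apply_def, Sigma.mk.injEq, heq_eq_eq, true_and]
      split_ifs <;> rfl
    · simp only [Pi.mulSingle_eq_of_ne hc, Equiv.Perm.coe_one, id_eq]
      rw [Equiv.swap_apply_of_ne_of_ne] <;> simp [hc]
  · rw [blockSign_apply, Finset.prod_eq_single b]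
    · simp [Equiv.Perm.sign_swap hij]
    · intro c _ hc; simp [Pi.mulSingle_eq_of_ne hc]
    · simp

section Boxes

variable {n : ℕ} (p : ℕ) (lam : Fin n → ℕ)

/-- The boxes of a diagram, arranged by columns. -/
abbrev Boxes : Type := Σ c : Fin p, Fin (conj lam c)

/-- The row of a box. -/
def boxRow (x : Boxes p lam) : Fin n := Fin.castLE (conj_le lam x.1) x.2

/-- The column-antisymmetrization of the filling of each box by its row. -/
def boxWeight (K : Boxes p lam → Fin n) : ℤ :=
  ∑ g, if K = boxRow p lam ∘ blockAct (fun c : Fin p => conj lam c) g then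
    (blockSign (fun c : Fin p => conj lam c) g : ℤ) else 0

theorem boxWeight_comp (K : Boxes p lam → Fin n)
    (g : (c : Fin p) → Equiv.Perm (Fin (conj lam c))) :
    boxWeight p lam (K ∘ blockAct (fun c : Fin p => conj lam c) g) =
      blockSign (fun c : Fin p => conj lam c) g * boxWeight p lam K := by
  simp only [boxWeight]
  rw [← Equiv.sum_comp (Equiv.mulRight g), Finset.mul_sum]
  refine Finset.sum_congr rfl fun h _ => ?_
  simp only [Equiv.coe_mulRight, map_mul, Equiv.Perm.coe_mul, ← Function.comp_assoc]
  simp only [(Equiv.surjective _).injective_comp_right.eq_iff, mul_ite, mul_zero, Units.val_mul]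
  congr 1
  ring

theorem boxWeight_boxRow : boxWeight p lam (boxRow p lam) = 1 := by
  rw [boxWeight, Finset.sum_eq_single 1]
  · simp
  · intro g _ hg
    refine if_neg fun h => hg ?_
    funext c
    ext j
    have := congrArg Fin.val (congrFun h ⟨c, j⟩)
    exact this.symm
  · simp

variable {p lam}

theorem sum_min_conj (hlam : Antitone lam) (hp : ∑ i, lam i = p) (r : ℕ) :
    ∑ c : Fin p, min r (conj lam c) = prefixSum lam r := by
  have h1 (c : Fin p) : min r (conj lam c) =
      ∑ i : Fin n, if (i : ℕ) < r then (if (c : ℕ) < lam i then 1 else 0) else 0 := by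
    have e : (Finset.univ.filter fun i : Fin n => (i : ℕ) < r ∧ (c : ℕ) < lam i) =
        Finset.univ.filter fun i : Fin n => (i : ℕ) < min r (conj lam c) := by
      ext i
      simp [lt_conj_iff hlam]
    simp only [← ite_and]
    rw [← Finset.card_filter, e, card_filter_val_lt ((min_le_right _ _).trans (conj_le _ _))]
  simp only [h1]
  rw [Finset.sum_comm, prefixSum]
  refine Finset.sum_congr rfl fun i _ => ?_
  split_ifs
  · rw [← Finset.card_filter, card_filter_val_lt (le_of_sum_eq hp i)]
  · simp

theorem card_boxes (hlam : Antitone lam) (hp : ∑ i, lam i = p) :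
    Fintype.card (Boxes p lam) = p := by
  have h := sum_min_conj hlam hp n
  have h2 : prefixSum lam n = p := by simp [prefixSum, hp]
  rw [h2] at h
  simpa [conj_le] using h

theorem card_filter_of_boxWeight_ne_zero (hlam : Antitone lam) (hp : ∑ i, lam i = p)
    {K : Boxes p lam → Fin n} (hK : boxWeight p lam K ≠ 0) (r : ℕ) :
    (Finset.univ.filter fun x => (K x : ℕ) < r).card = prefixSum lam r := by
  obtain ⟨g, -, hg⟩ := Finset.exists_ne_zero_of_sum_ne_zero hK
  obtain ⟨rfl, -⟩ := ite_ne_right_iff.1 hg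
  rw [← sum_min_conj hlam hp, Finset.card_filter]
  simp only [Function.comp_apply]
  rw [Equiv.sum_comp (blockAct (fun c : Fin p => conj lam c) g) fun x =>
    if (boxRow p lam x : ℕ) < r then 1 else 0, Fintype.sum_sigma]
  refine Finset.sum_congr rfl fun c _ => ?_
  rw [← Finset.card_filter, min_comm, ← Fin.card_filter_val_lt]
  rfl

end Boxes

/-! ### Values of the functional -/

section Values

variable {n p : ℕ} {lam : Fin n → ℕ}

theorem prefixSum_le_of_functional_hsymm_ne_zero (hlam : Antitone lam) (hp : ∑ i, lam i = p)
    (α : Fin n → ℕ) (hα : ∑ i, α i = p)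
    (hne : functional (boxWeight p lam) (∏ i, hsymm (Fin n) ℤ (α i)) ≠ 0) (r : ℕ) :
    prefixSum α r ≤ prefixSum lam r := by
  have hpoly : (∏ i, (α i).factorial) • ∏ i, hsymm (Fin n) ℤ (α i) =
      ∑ g, (((1 : ((b : Fin n) → Equiv.Perm (Fin (α b))) →* ℤˣ) g : ℤˣ) : ℤ) •
        fixPoly n Finset.univ (blockAct α g) := by
    have := prod_sum_fixPoly n α fun _ _ => 1
    simp only [one_smul, sum_fixPoly_eq_hsymm, Finset.prod_const_one] at this
    simp only [MonoidHom.one_apply, Units.val_one, one_smul]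
    rw [← this]
    simp [Finset.prod_mul_distrib]
  have hcard : Fintype.card (Σ b, Fin (α b)) = Fintype.card (Boxes p lam) := by
    rw [card_boxes hlam hp]; simpa using hα
  have hne' : functional (boxWeight p lam)
      ((∏ i, (α i).factorial) • ∏ i, hsymm (Fin n) ℤ (α i)) ≠ 0 := by
    rw [map_nsmul, nsmul_eq_mul]
    refine mul_ne_zero ?_ hne
    exact_mod_cast Finset.prod_ne_zero_iff.2 fun i _ => (α i).factorial_ne_zero
  rw [hpoly, functional_sum_fixPoly_univ _ hcard, Int.cast_ne_zero] at hne'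
  obtain ⟨θ, -, hθ⟩ := Finset.exists_ne_zero_of_sum_ne_zero hne'
  obtain ⟨J, -, hJ⟩ := Finset.exists_ne_zero_of_sum_ne_zero hθ
  have hcol : ∀ x y : Σ b, Fin (α b), x ≠ y → x.1 = y.1 → (θ x).1 ≠ (θ y).1 := by
    intro x y hxy hb hc
    obtain ⟨t, ht, -⟩ := exists_blockAct_eq_swap hxy hb
    obtain ⟨t', ht', hs'⟩ := exists_blockAct_eq_swap (θ.injective.ne hxy) hc
    apply right_ne_zero_of_mul hJ
    refine sum_sign_eq_zero_right _ t fun g => ?_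
    have e : J ∘ blockAct α (g * t) ∘ θ.symm =
        (J ∘ blockAct α g ∘ θ.symm) ∘ blockAct (fun c : Fin p => conj lam c) t' := by
      rw [ht', map_mul, ht]
      funext z
      simp only [Function.comp_apply, Equiv.Perm.coe_mul]
      rw [← Equiv.symm_apply_apply θ x, ← Equiv.symm_apply_apply θ y] 
      simp only [Equiv.apply_symm_apply]
      rw [← θ.symm.injective.map_swap]
    rw [e, boxWeight_comp, hs']
    simp
  have h1 : prefixSum α r = (Finset.univ.filter fun x : Σ b, Fin (α b) => (x.1 : ℕ) < r).card := by
    rw [Finset.card_filter, Fintype.sum_sigma, prefixSum]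
    refine Finset.sum_congr rfl fun b _ => ?_
    split_ifs <;> simp
  rw [h1, ← sum_min_conj hlam hp, Finset.card_eq_sum_card_fiberwise (f := fun x => (θ x).1)
    (t := Finset.univ) fun _ _ => Finset.mem_coe.2 (Finset.mem_univ _)]
  refine Finset.sum_le_sum fun c _ => le_min ?_ ?_
  · have : r = (Finset.range r).card := by simp
    rw [this]
    refine Finset.card_le_card_of_injOn (fun x => (x.1 : ℕ)) ?_ ?_
    · intro x hx
      simp only [Finset.coe_filter, Finset.mem_filter, Finset.mem_univ, true_and,
        Set.mem_ofPred_eq] at hx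
      simpa using hx.1
    · intro x hx y hy hxy
      simp only [Finset.coe_filter, Finset.mem_filter, Finset.mem_univ, true_and,
        Set.mem_ofPred_eq] at hx hy
      by_contra hne
      exact hcol x y hne (Fin.ext hxy) (hx.2.trans hy.2.symm)
  · have : conj lam c = (Finset.univ.map (Function.Embedding.sigmaMk (β := fun c : Fin p =>
      Fin (conj lam c)) c)).card := by simp
    rw [this]
    refine Finset.card_le_card_of_injOn θ ?_ θ.injective.injOn
    intro x hx
    simp only [Finset.coe_filter, Finset.mem_filter, Finset.mem_univ, true_and,
      Set.mem_ofPred_eq] at hx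
    simp only [Finset.coe_map, Function.Embedding.sigmaMk_apply, Finset.coe_univ, Set.image_univ,
      Set.mem_range]
    refine ⟨Fin.cast (by rw [hx.2]) (θ x).2, ?_⟩
    obtain ⟨-, rfl⟩ := hx
    rfl

theorem smul_esymmCols (κ : Fin n → ℕ) :
    (∏ c : Fin p, (conj κ c).factorial) • esymmCols n p κ =
      ∑ g, (blockSign (fun c : Fin p => conj κ c) g : ℤ) •
        fixPoly n Finset.univ (blockAct (fun c : Fin p => conj κ c) g) := by
  have := prod_sum_fixPoly n (fun c : Fin p => conj κ c) fun _ σ => (Equiv.Perm.sign σ : ℤ)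
  simp only [sum_sign_smul_fixPoly_eq_esymm] at this
  simp only [blockSign_apply, Units.coe_prod]
  rw [← this, esymmCols]
  simp [Finset.prod_mul_distrib]

theorem dominated_of_functional_esymmCols_ne_zero (hlam : Antitone lam) (hp : ∑ i, lam i = p)
    (κ : Fin n → ℕ) (hκ : Antitone κ) (hκp : ∑ i, κ i = p)
    (hne : functional (boxWeight p lam) (esymmCols n p κ) ≠ 0) : Dominated lam κ := by
  refine ⟨fun r => ?_, hp.trans hκp.symm⟩
  have hcard : Fintype.card (Boxes p κ) = Fintype.card (Boxes p lam) := by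
    rw [card_boxes hlam hp, card_boxes hκ hκp]
  have hne' : functional (boxWeight p lam)
      ((∏ c : Fin p, (conj κ c).factorial) • esymmCols n p κ) ≠ 0 := by
    rw [map_nsmul, nsmul_eq_mul]
    refine mul_ne_zero ?_ hne
    rw [Nat.cast_ne_zero, Finset.prod_ne_zero_iff]
    exact fun c _ => (conj κ c).factorial_ne_zero
  rw [smul_esymmCols, functional_sum_fixPoly_univ _ hcard, Int.cast_ne_zero] at hne'
  obtain ⟨θ, -, hθ⟩ := Finset.exists_ne_zero_of_sum_ne_zero hne'
  obtain ⟨J, -, hJ⟩ := Finset.exists_ne_zero_of_sum_ne_zero hθ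
  have hinj : ∀ x y : Boxes p κ, x ≠ y → x.1 = y.1 → J x ≠ J y := by
    intro x y hxy hb hc
    obtain ⟨t, ht, hs⟩ := exists_blockAct_eq_swap hxy hb
    apply right_ne_zero_of_mul hJ
    refine sum_sign_eq_zero _ _ t hs fun g => ?_
    have e : J ∘ Equiv.swap x y = J := by
      funext z
      simp only [Function.comp_apply, Equiv.swap_apply_def]
      split_ifs with h1 h2
      · rw [h1, hc]
      · rw [h2, hc]
      · rfl
    rw [map_mul, Equiv.Perm.coe_mul, ht, Function.comp_assoc, ← Function.comp_assoc J, e]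
  rw [← card_filter_of_boxWeight_ne_zero hlam hp (left_ne_zero_of_mul hJ), ← sum_min_conj hκ hκp,
    Finset.card_filter]
  simp only [Function.comp_apply]
  rw [Equiv.sum_comp θ.symm fun x => if (J x : ℕ) < r then 1 else 0, Fintype.sum_sigma]
  refine Finset.sum_le_sum fun c _ => ?_
  rw [← Finset.card_filter]
  refine le_min ?_ ((Finset.card_le_univ _).trans_eq (Fintype.card_fin _))
  have : r = (Finset.range r).card := by simp
  rw [this]
  refine Finset.card_le_card_of_injOn (fun j => (J ⟨c, j⟩ : ℕ)) ?_ ?_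
  · intro x hx
    simpa using hx
  · intro x _ y _ hxy
    by_contra hne
    refine hinj ⟨c, x⟩ ⟨c, y⟩ ?_ rfl (Fin.ext hxy)
    simpa using hne

theorem exists_functional_esymmCols_pos :
    ∃ N z : ℤ, 0 < N ∧ 0 < z ∧ (N : ℂ) * functional (boxWeight p lam) (esymmCols n p lam) = z := by
  have hval := functional_sum_fixPoly_univ (boxWeight p lam) rfl
    (blockAct fun c : Fin p => conj lam c) (blockSign fun c : Fin p => conj lam c)
  rw [← smul_esymmCols, map_nsmul, nsmul_eq_mul, ← Int.cast_natCast] at hval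
  refine ⟨_, _, ?_, ?_, hval⟩
  · exact Int.natCast_pos.2 (Finset.prod_pos fun c _ => (conj lam c).factorial_pos)
  · refine Finset.sum_pos' (fun θ _ => ?_) ⟨Equiv.refl _, Finset.mem_univ _, ?_⟩
    · have := sum_sign_mul_nonneg (blockAct fun c : Fin p => conj lam c)
        (blockSign fun c : Fin p => conj lam c) fun J => boxWeight p lam (J ∘ θ.symm)
      refine this.trans_eq ?_
      simp only [Finset.mul_sum]
      rw [Finset.sum_comm]
      exact Finset.sum_congr rfl fun J _ => Finset.sum_congr rfl fun g _ => by
        rw [Function.comp_assoc]; ring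
    · have e (J : Boxes p lam → Fin n) (g : (c : Fin p) → Equiv.Perm (Fin (conj lam c))) :
          (blockSign (fun c : Fin p => conj lam c) g : ℤ) * boxWeight p lam
            (J ∘ blockAct (fun c : Fin p => conj lam c) g) = boxWeight p lam J := by
        have hh := congrArg Units.val (Int.units_mul_self (blockSign (fun c : Fin p => conj lam c) g))
        rw [Units.val_mul, Units.val_one] at hh
        rw [boxWeight_comp, ← mul_assoc, hh, one_mul]
      simp only [e, Equiv.refl_symm, Equiv.coe_refl, Function.comp_id, Finset.sum_const, nsmul_eq_mul]
      refine Finset.sum_pos' (fun J _ => ?_) ⟨boxRow p lam, Finset.mem_univ _, ?_⟩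
      · rw [mul_left_comm]
        exact mul_nonneg (Int.natCast_nonneg _) (mul_self_nonneg _)
      · rw [boxWeight_boxRow, one_mul, mul_one, Finset.card_univ]
        exact_mod_cast Fintype.card_pos

theorem prefixSum_le_prefixSum_perm (μ : Fin n → ℕ) (σ : Equiv.Perm (Fin n)) (α : Fin n → ℕ)
    (hα : ∀ i, (α i : ℤ) = (μ i : ℤ) - (i : ℕ) + (σ i : ℕ)) (r : ℕ) :
    prefixSum μ r ≤ prefixSum α r := by
  have hmono : Monotone fun j : Fin n => ((j : ℕ) : ℤ) := fun i j hij =>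
    Int.ofNat_le.2 hij
  have hg : Antitone fun j : Fin n => if (j : ℕ) < r then (1 : ℤ) else 0 := by
    intro i j hij
    have h2 : (i : ℕ) ≤ j := hij
    simp only
    split_ifs <;> omega
  have h := (hmono.antivary hg).sum_mul_le_sum_comp_perm_mul (σ := σ)
  have e : (prefixSum α r : ℤ) = prefixSum μ r +
      (∑ j : Fin n, ((σ j : ℕ) : ℤ) * (if (j : ℕ) < r then (1 : ℤ) else 0) -
        ∑ j : Fin n, ((j : ℕ) : ℤ) * (if (j : ℕ) < r then (1 : ℤ) else 0)) := by
    rw [prefixSum, prefixSum, ← Finset.sum_sub_distrib]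
    push_cast
    rw [← Finset.sum_add_distrib]
    refine Finset.sum_congr rfl fun j _ => ?_
    split_ifs
    · rw [hα]; ring
    · simp
  zify
  rw [e]
  linarith

theorem dominated_of_functional_schurInt_ne_zero (hlam : Antitone lam) (hp : ∑ i, lam i = p)
    (μ : Fin n → ℕ) (hμp : ∑ i, μ i = p)
    (hne : functional (boxWeight p lam) (schurInt n μ) ≠ 0) : Dominated μ lam := by
  rw [schurInt, Matrix.det_apply, map_sum] at hne
  obtain ⟨σ, -, hσ⟩ := Finset.exists_ne_zero_of_sum_ne_zero hne
  rw [Units.smul_def, map_zsmul] at hσ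
  have hσ' := right_ne_zero_of_smul hσ
  simp only [Matrix.of_apply] at hσ'
  rw [← Equiv.prod_comp σ.symm] at hσ'
  simp only [Equiv.apply_symm_apply] at hσ'
  have hnn : ∀ i, 0 ≤ (μ i : ℤ) - (i : ℕ) + (σ.symm i : ℕ) := by
    intro i
    by_contra hc
    apply hσ'
    rw [Finset.prod_eq_zero (Finset.mem_univ i) (by rw [hFromInt, if_neg hc]), map_zero]
  choose α hα using fun i => Int.eq_ofNat_of_zero_le (hnn i)
  simp only [hα, hFromInt_natCast, ← hsymm_eq_hFrom] at hσ'
  have hαp : ∑ i, α i = p := by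
    rw [← hμp]
    zify
    simp only [← hα, Finset.sum_add_distrib, Finset.sum_sub_distrib]
    rw [Equiv.sum_comp σ.symm fun j : Fin n => ((j : ℕ) : ℤ)]
    ring
  exact ⟨fun r => (prefixSum_le_prefixSum_perm μ σ.symm α (fun i => (hα i).symm) r).trans
    (prefixSum_le_of_functional_hsymm_ne_zero hlam hp α hαp hσ' r), hμp.trans hp.symm⟩

theorem functional_C_mul {B : Type*} [Fintype B] [DecidableEq B] (w : (B → Fin n) → ℤ) (c : ℤ)
    (g : MvPolynomial (Fin n) ℤ) : functional w (C c * g) = c * functional w g := by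
  rw [C_mul', map_smul, zsmul_eq_mul]

theorem schurInt_eq_sum_esymmCols (μ : Fin n → ℕ) (hμ : μ ∈ parts n p) :
    ∃ b : (Fin n → ℕ) → ℤ, schurInt n μ = ∑ κ ∈ parts n p, C (b κ) * esymmCols n p κ ∧
      ∀ κ, b κ ≠ 0 → Dominated κ μ := by
  obtain ⟨hanti, hsum⟩ := mem_parts.1 hμ
  refine exists_expansion _ (fun κ hκ => ⟨isSymmetric_esymmCols n p κ,
    hasLead_esymmCols κ (mem_parts.1 hκ).1 (mem_parts.1 hκ).2⟩) (fun κ => Dominated κ μ)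
    (fun d e h h' => h.trans h') _ (isSymmetric_schurInt n μ) fun d _ hd => ?_
  have := (hasLead_schurInt μ hanti).1 _ hd
  exact ⟨this.2.trans hsum, this⟩

theorem functional_schurInt_of_ne (hlam : lam ∈ parts n p) (μ : Fin n → ℕ) (hμ : μ ∈ parts n p)
    (hne : μ ≠ lam) : functional (boxWeight p lam) (schurInt n μ) = 0 := by
  obtain ⟨hl, hlp⟩ := mem_parts.1 hlam
  by_contra hc
  apply hne
  refine (dominated_of_functional_schurInt_ne_zero hl hlp μ (mem_parts.1 hμ).2 hc).antisymm ?_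
  obtain ⟨b, hb, hbD⟩ := schurInt_eq_sum_esymmCols μ hμ
  rw [hb, map_sum] at hc
  obtain ⟨κ, hκ, hκne⟩ := Finset.exists_ne_zero_of_sum_ne_zero hc
  rw [functional_C_mul] at hκne
  exact (dominated_of_functional_esymmCols_ne_zero hl hlp κ (mem_parts.1 hκ).1 (mem_parts.1 hκ).2
    (right_ne_zero_of_mul hκne)).trans (hbD κ (by exact_mod_cast left_ne_zero_of_mul hκne))

theorem functional_schurInt_self (hlam : lam ∈ parts n p) :
    functional (boxWeight p lam) (schurInt n lam) =
      functional (boxWeight p lam) (esymmCols n p lam) := by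
  obtain ⟨hl, hlp⟩ := mem_parts.1 hlam
  obtain ⟨b, hb, hbD⟩ := schurInt_eq_sum_esymmCols lam hlam
  have hone : b lam = 1 := by
    have h := (hasLead_schurInt lam hl).2
    rw [hb, coeff_sum, Finset.sum_eq_single lam, coeff_C_mul, (hasLead_esymmCols lam hl hlp).2,
      mul_one] at h
    · exact h
    · intro κ hκ hne
      rw [coeff_C_mul]
      by_contra hc
      exact hne ((hbD κ (left_ne_zero_of_mul hc)).antisymm ((hasLead_esymmCols κ (mem_parts.1 hκ).1
        (mem_parts.1 hκ).2).1 _ (right_ne_zero_of_mul hc)))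
    · exact fun h => absurd hlam h
  rw [hb, map_sum, Finset.sum_eq_single lam, functional_C_mul, hone, Int.cast_one, one_mul]
  · intro κ hκ hne
    rw [functional_C_mul]
    by_contra hc
    exact hne ((hbD κ (by exact_mod_cast left_ne_zero_of_mul hc)).antisymm
      (dominated_of_functional_esymmCols_ne_zero hl hlp κ (mem_parts.1 hκ).1 (mem_parts.1 hκ).2
        (right_ne_zero_of_mul hc)))
  · exact fun h => absurd hlam h

end Values

/-! ### The wreath product action on `Fin p × Fin k` -/

section Wreath

variable (p k : ℕ)

/-- The wreath product of `Perm (Fin k)` by `Perm (Fin p)`. -/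
abbrev Wreath : Type :=
  (Fin p → Equiv.Perm (Fin k)) ⋊[mulAutArrow] Equiv.Perm (Fin p)

instance : Fintype (Wreath p k) := Fintype.ofEquiv _ SemidirectProduct.equivProd.symm

/-- Row-wise action of a family of permutations. -/
def rowAct : (Fin p → Equiv.Perm (Fin k)) →* Equiv.Perm (Fin p × Fin k) where
  toFun τ := Equiv.prodShear (Equiv.refl _) τ
  map_one' := by ext ⟨s, j⟩ <;> rfl
  map_mul' _ _ := by ext ⟨s, j⟩ <;> rfl

/-- Permutation of the rows. -/
def rowPerm : Equiv.Perm (Fin p) →* Equiv.Perm (Fin p × Fin k) where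
  toFun π := Equiv.prodCongr π (Equiv.refl _)
  map_one' := by ext ⟨s, j⟩ <;> rfl
  map_mul' _ _ := by ext ⟨s, j⟩ <;> rfl

/-- The imprimitive action of the wreath product. -/
def wreathAct : Wreath p k →* Equiv.Perm (Fin p × Fin k) :=
  SemidirectProduct.lift (rowAct p k) (rowPerm p k) fun π => by
    refine MonoidHom.ext fun τ => Equiv.ext fun ⟨s, j⟩ => Prod.ext ?_ rfl
    exact (π.apply_symm_apply s).symm

/-- The sign of the row permutation times the signs of the permutations inside the rows. -/
def wreathSign : Wreath p k →* ℤˣ :=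
  SemidirectProduct.lift (∏ s, Equiv.Perm.sign.comp (Pi.evalMonoidHom _ s)) Equiv.Perm.sign
    fun π => by
      ext τ
      have h (τ : Fin p → Equiv.Perm (Fin k)) :
          (∏ s, Equiv.Perm.sign.comp (Pi.evalMonoidHom _ s) : _ →* ℤˣ) τ =
            ∏ s, Equiv.Perm.sign (τ s) := by simp [MonoidHom.finsetProd_apply]
      simp only [MonoidHom.comp_apply, MulEquiv.coe_toMonoidHom, MulAut.conj_apply, h]
      rw [mul_inv_cancel_comm]
      congr 1
      exact Equiv.prod_comp π⁻¹ fun s => Equiv.Perm.sign (τ s)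

variable {p k}

theorem wreathAct_apply (g : Wreath p k) (s : Fin p) (j : Fin k) :
    wreathAct p k g (s, j) = (g.right s, g.left (g.right s) j) := rfl

theorem wreathSign_apply (g : Wreath p k) :
    wreathSign p k g = (∏ s, Equiv.Perm.sign (g.left s)) * Equiv.Perm.sign g.right := by
  simp [wreathSign, SemidirectProduct.lift, MonoidHom.finsetProd_apply]

/-- The rows of `J` are injective with pairwise distinct images. -/
def DistinctRows {n : ℕ} (J : Fin p × Fin k → Fin n) : Prop :=
  (∀ s, Function.Injective fun j => J (s, j)) ∧
    Function.Injective fun s => Finset.univ.image fun j => J (s, j)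

theorem exists_wreathSign_eq_neg_one {n : ℕ} (J : Fin p × Fin k → Fin n) (hJ : ¬ DistinctRows J) :
    ∃ t, J ∘ wreathAct p k t = J ∧ wreathSign p k t = -1 := by
  classical
  by_cases hrow : ∀ s, Function.Injective fun j => J (s, j)
  · have hcol : ¬ Function.Injective fun s => Finset.univ.image fun j => J (s, j) :=
      fun h => hJ ⟨hrow, h⟩
    simp only [Function.Injective, not_forall] at hcol
    obtain ⟨s, s', himg, hne⟩ := hcol
    have hex : ∀ j, ∃ j', J (s', j') = J (s, j) := by
      intro j
      have : J (s, j) ∈ Finset.univ.image fun j => J (s', j) := himg ▸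
        Finset.mem_image_of_mem _ (Finset.mem_univ j)
      simpa using this
    choose f hf using hex
    have hfinj : Function.Injective f := fun i j hij => hrow s (by
      simp only [← hf, hij])
    let τ : Equiv.Perm (Fin k) := Equiv.ofBijective f (Finite.injective_iff_bijective.1 hfinj)
    have hτ : ∀ j, J (s', τ j) = J (s, j) := hf
    refine ⟨⟨Pi.mulSingle s' τ * Pi.mulSingle s τ⁻¹, Equiv.swap s s'⟩, ?_, ?_⟩
    · funext ⟨x, j⟩
      rw [Function.comp_apply, wreathAct_apply]
      simp only [Pi.mul_apply]
      by_cases h1 : x = s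
      · subst h1
        rw [Equiv.swap_apply_left, Pi.mulSingle_eq_same, Pi.mulSingle_eq_of_ne (Ne.symm hne), mul_one,
          hτ]
      · by_cases h2 : x = s'
        · subst h2
          rw [Equiv.swap_apply_right, Pi.mulSingle_eq_same, Pi.mulSingle_eq_of_ne hne, one_mul, ← hτ]
          simp
        · rw [Equiv.swap_apply_of_ne_of_ne h1 h2, Pi.mulSingle_eq_of_ne h1, Pi.mulSingle_eq_of_ne h2]
          rfl
    · rw [wreathSign_apply]
      simp only [Pi.mul_apply, map_mul, Finset.prod_mul_distrib]
      rw [Finset.prod_eq_single s', Finset.prod_eq_single s]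
      · simp [Equiv.Perm.sign_swap hne]
      · intro x _ hx; simp [Pi.mulSingle_eq_of_ne hx]
      · simp
      · intro x _ hx; simp [Pi.mulSingle_eq_of_ne hx]
      · simp
  · simp only [Function.Injective, not_forall] at hrow
    obtain ⟨s, i, j, hij, hne⟩ := hrow
    refine ⟨⟨Pi.mulSingle s (Equiv.swap i j), 1⟩, ?_, ?_⟩
    · funext ⟨x, l⟩
      rw [Function.comp_apply, wreathAct_apply]
      simp only [Equiv.Perm.coe_one, id_eq]
      by_cases h : x = s
      · subst h
        rw [Pi.mulSingle_eq_same, Equiv.swap_apply_def]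
        split_ifs with h1 h2
        · rw [h1]; exact hij.symm
        · rw [h2]; exact hij
        · rfl
      · rw [Pi.mulSingle_eq_of_ne h]; rfl
    · rw [wreathSign_apply, Finset.prod_eq_single s]
      · simp [Equiv.Perm.sign_swap hne]
      · intro x _ hx; simp [Pi.mulSingle_eq_of_ne hx]
      · simp

theorem eq_one_of_distinctRows {n : ℕ} (J : Fin p × Fin k → Fin n) (hJ : DistinctRows J)
    (g : Wreath p k) (hg : J ∘ wreathAct p k g = J) : g = 1 := by
  have hg' (s : Fin p) (j : Fin k) : J (g.right s, g.left (g.right s) j) = J (s, j) :=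
    congrFun hg (s, j)
  have hright : ∀ s, g.right s = s := by
    intro s
    apply hJ.2
    simp only
    ext a
    simp only [Finset.mem_image, Finset.mem_univ, true_and]
    constructor
    · rintro ⟨j, rfl⟩
      refine ⟨(g.left (g.right s)).symm j, ?_⟩
      rw [← hg', Equiv.apply_symm_apply]
    · rintro ⟨j, rfl⟩
      exact ⟨_, hg' s j⟩
  refine SemidirectProduct.ext ?_ ?_
  · funext s
    ext1 j
    have := hg' s j
    rw [hright] at this
    exact hJ.1 s this
  · ext1 s
    exact hright s

end Wreath

/-! ### The alphabet of `k`-fold sums -/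

section Alphabet

variable (n k p : ℕ)

/-- The elementary symmetric polynomial of the alphabet of `k`-fold sums, with integer
coefficients. -/
noncomputable def esymmAlphabetInt : MvPolynomial (Fin n) ℤ :=
  ∑ F ∈ ((Finset.univ : Finset (Fin n)).powersetCard k).powersetCard p, ∏ S ∈ F, ∑ i ∈ S, X i

theorem isSymmetric_esymmAlphabetInt : (esymmAlphabetInt n k p).IsSymmetric := by
  intro e
  simp only [esymmAlphabetInt, map_sum, map_prod, rename_X]
  refine Finset.sum_equiv e.finsetCongr.finsetCongr (fun F => ?_) fun F _ => ?_
  · simp only [Finset.mem_powersetCard, Finset.subset_iff, Finset.mem_univ, implies_true, true_and,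
      Equiv.finsetCongr_apply, Finset.card_map, Finset.mem_map]
    refine and_congr_left fun _ => ⟨?_, fun h x hx => ?_⟩
    · rintro h _ ⟨x, hx, rfl⟩
      simpa using h hx
    · simpa using h ⟨x, hx, rfl⟩
  · simp

theorem isHomogeneous_esymmAlphabetInt : (esymmAlphabetInt n k p).IsHomogeneous p := by
  refine IsHomogeneous.sum _ _ _ fun F hF => ?_
  have h : (∏ S ∈ F, ∑ i ∈ S, X i : MvPolynomial (Fin n) ℤ).IsHomogeneous (∑ S ∈ F, 1) :=
    IsHomogeneous.prod _ _ _ fun S _ => IsHomogeneous.sum _ _ _ fun i _ => isHomogeneous_X ℤ i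
  simpa [(Finset.mem_powersetCard.1 hF).2] using h

variable {n k p}

theorem smul_sum_injective_image_eq (z : Fin k) (A : Finset (Fin n)) :
    k • (∑ j : Fin k → Fin n, if Function.Injective j ∧ Finset.univ.image j = A then
      (X (j z) : MvPolynomial (Fin n) ℤ) else 0) =
      if A ∈ (Finset.univ : Finset (Fin n)).powersetCard k then
        k.factorial • ∑ i ∈ A, X i else 0 := by
  classical
  split_ifs with hA
  · have hAk : A.card = k := (Finset.mem_powersetCard.1 hA).2
    have hiff (j : Fin k → Fin n) : (Function.Injective j ∧ Finset.univ.image j = A) ↔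
        (Function.Injective j ∧ ∀ i, j i ∈ A) := by
      refine and_congr_right fun hj => ⟨fun h i => h ▸ Finset.mem_image_of_mem _ (Finset.mem_univ i),
        fun h => Finset.eq_of_subset_of_card_le ?_ ?_⟩
      · intro a ha
        obtain ⟨i, -, rfl⟩ := Finset.mem_image.1 ha
        exact h i
      · rw [Finset.card_image_of_injective _ hj]; simp [hAk]
    have hswap (i : Fin k) : (∑ j : Fin k → Fin n,
        if Function.Injective j ∧ Finset.univ.image j = A then
          (X (j z) : MvPolynomial (Fin n) ℤ) else 0) =
        ∑ j : Fin k → Fin n, if Function.Injective j ∧ Finset.univ.image j = A then X (j i) else 0 := by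
      refine Fintype.sum_equiv (Equiv.arrowCongr (Equiv.swap z i) (Equiv.refl (Fin n))) _ _ fun j => ?_
      have e : Equiv.arrowCongr (Equiv.swap z i) (Equiv.refl (Fin n)) j = j ∘ Equiv.swap z i := by
        funext x; simp
      have himage : Finset.univ.image (j ∘ Equiv.swap z i) = Finset.univ.image j := by
        rw [← Finset.image_image, Finset.image_univ_equiv]
      rw [e]
      refine if_congr ?_ (by simp) rfl
      rw [himage, (Equiv.swap z i).injective_comp]
    have h1 : k • (∑ j : Fin k → Fin n, if Function.Injective j ∧ Finset.univ.image j = A then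
        (X (j z) : MvPolynomial (Fin n) ℤ) else 0) =
        ∑ i : Fin k, ∑ j : Fin k → Fin n,
          if Function.Injective j ∧ Finset.univ.image j = A then X (j i) else 0 := by
      rw [← Finset.sum_congr rfl fun i _ => hswap i]
      simp
    have h2 (j : Fin k → Fin n) : ∑ i : Fin k,
        (if Function.Injective j ∧ Finset.univ.image j = A then
          (X (j i) : MvPolynomial (Fin n) ℤ) else 0) =
        (if Function.Injective j ∧ ∀ i, j i ∈ A then ∏ _i : Fin k, 1 else 0) * ∑ i ∈ A, X i := by
      simp only [← hiff]
      split_ifs with h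
      · rw [← h.2, Finset.sum_image fun _ _ _ _ hh => h.1 hh]; simp
      · simp
    rw [h1, Finset.sum_comm, Finset.sum_congr rfl fun j _ => h2 j, ← Finset.sum_mul,
      sum_injective_prod k A fun _ => (1 : MvPolynomial (Fin n) ℤ)]
    have : A.powersetCard k = {A} := by rw [← hAk, Finset.powersetCard_self]
    simp [this]
  · rw [Finset.sum_eq_zero, smul_zero]
    intro j _
    refine if_neg fun h => hA ?_
    rw [← h.2, Finset.mem_powersetCard, Finset.card_image_of_injective _ h.1]
    simp

open Classical in
theorem smul_sum_distinctRows (z : Fin k) :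
    k ^ p • (∑ J : Fin p × Fin k → Fin n, if DistinctRows J then
      ∏ s, (X (J (s, z)) : MvPolynomial (Fin n) ℤ) else 0) =
      (p.factorial * k.factorial ^ p) • esymmAlphabetInt n k p := by
  let R (A : Finset (Fin n)) : MvPolynomial (Fin n) ℤ := ∑ j : Fin k → Fin n,
    if Function.Injective j ∧ Finset.univ.image j = A then X (j z) else 0
  have h1 : (∑ J : Fin p × Fin k → Fin n, if DistinctRows J then
      ∏ s, (X (J (s, z)) : MvPolynomial (Fin n) ℤ) else 0) =
      ∑ S : Fin p → Finset (Fin n), if Function.Injective S then ∏ s, R (S s) else 0 := by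
    simp only [R, prod_sum_pi]
    have e : ∀ S : Fin p → Finset (Fin n), (if Function.Injective S then
        ∑ K : Fin p → Fin k → Fin n, ∏ s,
          (if Function.Injective (K s) ∧ Finset.univ.image (K s) = S s then
            (X (K s z) : MvPolynomial (Fin n) ℤ) else 0) else 0) =
        ∑ K : Fin p → Fin k → Fin n, if S = (fun s => Finset.univ.image (K s)) then
          (if Function.Injective S ∧ ∀ s, Function.Injective (K s) then
            ∏ s, (X (K s z) : MvPolynomial (Fin n) ℤ) else 0) else 0 := by
      intro S
      split_ifs with hS
      · refine Finset.sum_congr rfl fun K _ => ?_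
        rw [Finset.prod_ite_zero]
        simp only [Finset.mem_univ, true_imp_iff, forall_and, hS, true_and, ← ite_and, funext_iff]
        refine if_congr ?_ rfl rfl
        rw [and_comm]
        simp only [eq_comm]
      · simp [hS]
    rw [Finset.sum_congr rfl fun S _ => e S, Finset.sum_comm]
    refine Fintype.sum_equiv (Equiv.curry _ _ _) _ _ fun J => ?_
    rw [Finset.sum_ite_eq', if_pos (Finset.mem_univ _)]
    refine if_congr ?_ rfl rfl
    rw [DistinctRows, and_comm]
    rfl
  have h2 (S : Fin p → Finset (Fin n)) :
      k ^ p • (if Function.Injective S then ∏ s, R (S s) else 0) =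
      if Function.Injective S ∧ ∀ s, S s ∈ (Finset.univ : Finset (Fin n)).powersetCard k then
        ∏ s, k.factorial • ∑ i ∈ S s, (X i : MvPolynomial (Fin n) ℤ) else 0 := by
    by_cases hS : Function.Injective S
    · have e : k ^ p • ∏ s, R (S s) = ∏ s, k • R (S s) := by
        simp [Finset.prod_mul_distrib]
      rw [if_pos hS, e]
      simp only [R, smul_sum_injective_image_eq]
      rw [Finset.prod_ite_zero]
      simp [hS]
    · simp [hS]
  rw [h1, Finset.smul_sum, Finset.sum_congr rfl fun S _ => h2 S,
    sum_injective_prod p ((Finset.univ : Finset (Fin n)).powersetCard k)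
      fun A => k.factorial • ∑ i ∈ A, (X i : MvPolynomial (Fin n) ℤ), mul_smul]
  congr 1
  rw [esymmAlphabetInt, Finset.smul_sum]
  refine Finset.sum_congr rfl fun F hF => ?_
  simp [Finset.prod_mul_distrib, (Finset.mem_powersetCard.1 hF).2]

theorem exists_functional_esymmAlphabetInt_nonneg (hk : 1 ≤ k) {B : Type*} [Fintype B]
    [DecidableEq B] (w : (B → Fin n) → ℤ) (hB : Fintype.card B = p) :
    ∃ N z : ℤ, 0 < N ∧ 0 ≤ z ∧ (N : ℂ) * functional w (esymmAlphabetInt n k p) = z := by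
  classical
  let z₀ : Fin k := ⟨0, hk⟩
  let S : Finset (Fin p × Fin k) := Finset.univ ×ˢ {z₀}
  obtain ⟨z, hz, hzval⟩ := functional_sum_nonneg (wreathAct p k) (wreathSign p k) w S
    (by simp [S, hB])
  rw [sum_sign_smul_fixPoly n (wreathAct p k) (wreathSign p k) S DistinctRows
    exists_wreathSign_eq_neg_one eq_one_of_distinctRows] at hzval
  have hprod (J : Fin p × Fin k → Fin n) :
      ∏ i ∈ S, (X (J i) : MvPolynomial (Fin n) ℤ) = ∏ s, X (J (s, z₀)) := by
    rw [Finset.prod_product]; simp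
  simp only [hprod] at hzval
  refine ⟨(p.factorial * k.factorial ^ p : ℕ), k ^ p * z, ?_, by positivity, ?_⟩
  · exact_mod_cast Nat.mul_pos p.factorial_pos (pow_pos k.factorial_pos p)
  · rw [Int.cast_natCast, ← nsmul_eq_mul, ← map_nsmul, ← smul_sum_distinctRows z₀, map_nsmul, hzval]
    simp

theorem exists_esymmAlphabetInt_eq_sum (hk : 1 ≤ k) :
    ∃ c : (Fin n → ℕ) → ℕ,
      esymmAlphabetInt n k p = ∑ μ ∈ parts n p, C (c μ : ℤ) * schurInt n μ := by
  obtain ⟨b, hb, -⟩ := exists_expansion (schurInt n) (p := p) (fun κ hκ =>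
    ⟨isSymmetric_schurInt n κ, hasLead_schurInt κ (mem_parts.1 hκ).1⟩) (fun _ => True)
    (fun _ _ _ _ => trivial) _ (isSymmetric_esymmAlphabetInt n k p) fun d _ hd => ⟨by
      have := isHomogeneous_esymmAlphabetInt n k p hd
      simpa [Finsupp.weight_apply, Finsupp.sum_fintype] using this, trivial⟩
  have hnonneg : ∀ lam ∈ parts n p, 0 ≤ b lam := by
    intro lam hlam
    obtain ⟨N, z, hN, hz, hval⟩ := exists_functional_esymmAlphabetInt_nonneg hk (boxWeight p lam)
      (card_boxes (mem_parts.1 hlam).1 (mem_parts.1 hlam).2)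
    obtain ⟨N', z', hN', hz', hval'⟩ := exists_functional_esymmCols_pos (n := n) (p := p) (lam := lam)
    rw [← functional_schurInt_self hlam] at hval'
    have h : functional (boxWeight p lam) (esymmAlphabetInt n k p) =
        b lam * functional (boxWeight p lam) (schurInt n lam) := by
      rw [hb, map_sum, Finset.sum_eq_single lam, functional_C_mul]
      · intro μ hμ hne
        rw [functional_C_mul, functional_schurInt_of_ne hlam μ hμ hne, mul_zero]
      · exact fun h => absurd hlam h
    have key : N * z' * b lam = N' * z := by
      have : (N : ℂ) * z' * b lam = N' * z := by
        rw [← hval', ← hval, h]; ring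
      exact_mod_cast this
    have h1 : 0 ≤ N * z' * b lam := key ▸ mul_nonneg hN'.le hz
    exact nonneg_of_mul_nonneg_right h1 (mul_pos hN hz')
  refine ⟨fun μ => (b μ).toNat, hb.trans (Finset.sum_congr rfl fun μ hμ => ?_)⟩
  rw [Int.toNat_of_nonneg (hnonneg μ hμ)]

end Alphabet

theorem map_esymmAlphabetInt (n k p : ℕ) :
    map (Int.castRingHom ℚ) (esymmAlphabetInt n k p) = esymmAlphabet n k p := by
  simp [esymmAlphabetInt, esymmAlphabet]

theorem map_schurInt (n : ℕ) (μ : Fin n → ℕ) :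
    map (Int.castRingHom ℚ) (schurInt n μ) = schur n μ := by
  rw [schurInt, schur, RingHom.map_det]
  congr 1
  ext1 i j
  simp only [RingHom.mapMatrix_apply, Matrix.map_apply, Matrix.of_apply, hFromInt, hInt,
    ← hsymm_eq_hFrom]
  split_ifs <;> simp [map_hsymm]

end SchurPositivity

theorem stmt2 (n k p : ℕ) (hk : 1 ≤ k) (hkn : k ≤ n) (hp : p ≤ n.choose k) :
    ∃ (P : Finset (Fin n → ℕ)) (c : (Fin n → ℕ) → ℕ),
      (∀ lam ∈ P, Antitone lam ∧ ∑ i, lam i = p) ∧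
      esymmAlphabet n k p = ∑ lam ∈ P, (c lam : MvPolynomial (Fin n) ℚ) * schur n lam := by
  obtain ⟨c, hc⟩ := SchurPositivity.exists_esymmAlphabetInt_eq_sum (n := n) (p := p) hk
  refine ⟨SchurPositivity.parts n p, c, fun lam h => SchurPositivity.mem_parts.1 h, ?_⟩
  rw [← SchurPositivity.map_esymmAlphabetInt, hc]
  simp [SchurPositivity.map_schurInt]
end

section
/- (Lascoux, exterior square) In ℚ[x_1,…,x_n] one has the identity 2^{binomial(n,2)} · ∏_{1 ≤ i < j ≤ n} (1 + x_i + x_j) = ∑_{μ ⊆ δ_{n−1}} d_{δ_{n−1},μ} · 2^{|μ|} · s_μ(x_1,…,x_n), where the sum is over all partitions μ contained in the staircase δ_{n−1} = (n−1, n−2, …, 1, 0). -/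
open MvPolynomial

/-- The binomial determinant `d_{λ,μ}` (partitions padded to length `n`,
`0`-indexed version of `det (C(λ_i + n − i, μ_j + n − j))_{1 ≤ i,j ≤ n}`). -/
def binomDet (n : ℕ) (lam mu : Fin n → ℕ) : ℤ :=
  (Matrix.of fun i j : Fin n =>
    ((lam i + (n - 1 - (i : ℕ))).choose (mu j + (n - 1 - (j : ℕ))) : ℤ)).det

/-- The staircase partition `δ_{n−1} = (n−1, n−2, …, 1, 0)`, padded to length `n`. -/
def staircase (n : ℕ) : Fin n → ℕ := fun i => n - 1 - (i : ℕ)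

open Finset Matrix in
/-- The Cauchy–Binet formula, the minors being indexed by strictly decreasing sequences. -/
theorem det_sum_mul_eq_sum_strictAnti {R : Type*} [CommRing R] {n : ℕ} (s : Finset ℕ)
    (c : Fin n → ℕ → R) (v : ℕ → Fin n → R) [DecidablePred (StrictAnti : (Fin n → ℕ) → Prop)] :
    (of fun i l => ∑ k ∈ s, c i k * v k l).det =
      ∑ g ∈ (Fintype.piFinset fun _ : Fin n => s).filter StrictAnti,
        (of fun i j => c i (g j)).det * (of fun j l => v (g j) l).det := by
  classical
  have expand : (of fun i l => ∑ k ∈ s, c i k * v k l).det =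
      ∑ f ∈ Fintype.piFinset fun _ : Fin n => s,
        (∏ i, c i (f i)) * (of fun i l => v (f i) l).det := by
    have h := (detRowAlternating (R := R) (n := Fin n)).toMultilinearMap.map_sum_finset
      (fun i k => c i k • v k) (fun _ => s)
    have h1 : (fun i => ∑ k ∈ s, c i k • v k) = fun i l => ∑ k ∈ s, c i k * v k l := by
      ext i l
      simp [Finset.sum_apply]
    rw [h1] at h
    refine h.trans (Finset.sum_congr rfl fun f _ => ?_)
    exact (detRowAlternating (R := R) (n := Fin n)).toMultilinearMap.map_smul_univ
      (fun i => c i (f i)) (fun i => v (f i))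
  have drop : ∑ f ∈ Fintype.piFinset fun _ : Fin n => s,
        (∏ i, c i (f i)) * (of fun i l => v (f i) l).det =
      ∑ f ∈ (Fintype.piFinset fun _ : Fin n => s).filter Function.Injective,
        (∏ i, c i (f i)) * (of fun i l => v (f i) l).det := by
    symm
    refine Finset.sum_filter_of_ne fun f _ hf i j hij => ?_
    by_contra hne
    exact hf (by rw [det_zero_of_row_eq hne (by ext l; simp [hij]), mul_zero])
  have minors : ∀ g : Fin n → ℕ,
      (of fun i j => c i (g j)).det * (of fun j l => v (g j) l).det =
        ∑ σ : Equiv.Perm (Fin n), (∏ i, c i (g (σ i))) * (of fun i l => v (g (σ i)) l).det := by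
    intro g
    rw [← det_transpose, det_apply', Finset.sum_mul]
    refine Finset.sum_congr rfl fun σ _ => ?_
    have := det_permute σ (of fun j l => v (g j) l)
    have h2 : (of fun i l => v (g (σ i)) l) = (of fun j l => v (g j) l).submatrix σ id := rfl
    rw [h2, this]
    simp only [transpose_apply, of_apply]
    ring
  rw [expand, drop, Finset.sum_congr rfl fun g _ => minors g, ← Finset.sum_product']
  symm
  refine Finset.sum_bij (fun p _ => p.1 ∘ p.2) ?_ ?_ ?_ ?_
  · rintro ⟨g, σ⟩ h
    simp only [mem_product, mem_filter, Fintype.mem_piFinset, mem_univ, and_true] at h ⊢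
    exact ⟨fun i => h.1 _, h.2.injective.comp σ.injective⟩
  · rintro ⟨g, σ⟩ h ⟨g', σ'⟩ h' heq
    simp only [mem_product, mem_filter, Fintype.mem_piFinset, mem_univ, and_true] at h h' heq
    have hr : Set.range (OrderDual.toDual ∘ g) = Set.range (OrderDual.toDual ∘ g') := by
      rw [← σ.surjective.range_comp (OrderDual.toDual ∘ g),
        ← σ'.surjective.range_comp (OrderDual.toDual ∘ g'), Function.comp_assoc, heq,
        Function.comp_assoc]
    have hg : OrderDual.toDual ∘ g = OrderDual.toDual ∘ g' :=
      (StrictMono.range_inj h.2.dual_right h'.2.dual_right).1 hr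
    have hg : g = g' := hg
    subst hg
    rw [Prod.mk.injEq]
    refine ⟨rfl, Equiv.ext fun i => h.2.injective (congrFun heq i)⟩
  · intro f h
    simp only [mem_filter, Fintype.mem_piFinset] at h
    have hm := Tuple.monotone_sort (OrderDual.toDual ∘ f)
    set τ := Tuple.sort (OrderDual.toDual ∘ f)
    refine ⟨(f ∘ τ, τ⁻¹), ?_, ?_⟩
    · simp only [mem_product, mem_filter, Fintype.mem_piFinset, mem_univ, and_true]
      refine ⟨fun i => h.1 _, ?_⟩
      have ha : Antitone (f ∘ τ) := fun i j hij => hm hij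
      exact ha.strictAnti_of_injective (h.2.comp τ.injective)
    · ext i
      simp
  · intro _ _
    rfl

/-- The generating function of the complete homogeneous symmetric polynomials. -/
theorem mk_hsymm_eq_prod (σ R : Type*) [Fintype σ] [DecidableEq σ] [CommRing R] :
    PowerSeries.mk (hsymm σ R) =
      ∏ l : σ, PowerSeries.mk fun m => (X l : MvPolynomial σ R) ^ m := by
  ext1 d
  rw [PowerSeries.coeff_prod, PowerSeries.coeff_mk, hsymm]
  simp only [PowerSeries.coeff_mk]
  refine Finset.sum_bij (fun s _ => Multiset.toFinsupp s.1) ?_ ?_ ?_ ?_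
  · intro s _
    simp only [Finset.mem_finsuppAntidiag, Multiset.toFinsupp_apply, Finset.subset_univ, and_true]
    exact (Multiset.sum_count_eq_card fun a _ => Finset.mem_univ a).trans s.2
  · intro s _ t _ h
    exact Subtype.ext (Multiset.toFinsupp.injective h)
  · intro f hf
    refine ⟨⟨Finsupp.toMultiset f, ?_⟩, Finset.mem_univ _, by simp⟩
    rw [Finsupp.card_toMultiset, Finsupp.sum_fintype _ _ (by simp)]
    exact (Finset.mem_finsuppAntidiag.1 hf).1
  · intro s _
    rw [Finset.prod_multiset_map_count]
    simp only [Multiset.toFinsupp_apply]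
    refine Finset.prod_subset (Finset.subset_univ _) fun i _ hi => ?_
    rw [Multiset.count_eq_zero_of_notMem (by simpa using hi), pow_zero]

theorem PowerSeries.mk_pow_mul_one_sub {R : Type*} [CommRing R] (a : R) :
    (PowerSeries.mk fun m => a ^ m) * (1 - PowerSeries.C a * PowerSeries.X) = 1 := by
  have h := congrArg (PowerSeries.rescale a) (PowerSeries.mk_one_mul_one_sub_eq_one R)
  rw [map_mul, map_sub, map_one, PowerSeries.rescale_X, PowerSeries.rescale_mk] at h
  simpa using h

/-- The polynomial `∏_{l ≠ i} (1 - x_l t)` in `t`. -/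
noncomputable def coProd (n : ℕ) (i : Fin n) : Polynomial (MvPolynomial (Fin n) ℚ) :=
  ∏ l ∈ Finset.univ.erase i, (1 - Polynomial.C (X l) * Polynomial.X)

theorem coProd_natDegree_lt (n : ℕ) (i : Fin n) : (coProd n i).natDegree < n := by
  have hn := i.pos
  refine (Polynomial.natDegree_prod_le _ _).trans_lt ?_
  refine (Finset.sum_le_card_nsmul _ _ 1 fun l _ => ?_).trans_lt ?_
  · compute_degree
  · simp [Finset.card_erase_of_mem]
    omega

theorem mk_hsymm_mul_coProd (n : ℕ) (i : Fin n) :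
    PowerSeries.mk (hsymm (Fin n) ℚ) * (coProd n i : PowerSeries (MvPolynomial (Fin n) ℚ)) =
      PowerSeries.mk fun m => X i ^ m := by
  have h : (coProd n i : PowerSeries (MvPolynomial (Fin n) ℚ)) =
      ∏ l ∈ Finset.univ.erase i, (1 - PowerSeries.C (X l) * PowerSeries.X) := by
    rw [coProd, ← Polynomial.coeToPowerSeries.ringHom_apply, map_prod]
    simp
  rw [h, mk_hsymm_eq_prod, ← Finset.mul_prod_erase _ _ (Finset.mem_univ i), mul_assoc,
    ← Finset.prod_mul_distrib]
  simp [PowerSeries.mk_pow_mul_one_sub]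

theorem X_pow_eq_sum_hInt_mul (n : ℕ) (i : Fin n) (m : ℕ) :
    (X i : MvPolynomial (Fin n) ℚ) ^ m =
      ∑ j : Fin n, hInt n ((m : ℤ) - (n - 1 : ℕ) + (j : ℕ)) * (coProd n i).coeff (n - 1 - j) := by
  have hn := i.pos
  have h := congrArg (PowerSeries.coeff m) (mk_hsymm_mul_coProd n i)
  rw [PowerSeries.coeff_mk, mul_comm, PowerSeries.coeff_mul,
    Finset.Nat.sum_antidiagonal_eq_sum_range_succ_mk] at h
  simp only [Polynomial.coeff_coe, PowerSeries.coeff_mk] at h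
  have key : ∀ b : ℕ, hInt n ((m : ℤ) - b) * (coProd n i).coeff b ≠ 0 →
      b ∈ Finset.range n ∧ b ∈ Finset.range m.succ := by
    intro b hb
    constructor
    · by_contra hbn
      rw [Finset.mem_range, not_lt] at hbn
      exact hb (by rw [Polynomial.coeff_eq_zero_of_natDegree_lt
        ((coProd_natDegree_lt n i).trans_le hbn), mul_zero])
    · by_contra hbm
      rw [Finset.mem_range, not_lt] at hbm
      exact hb (by rw [hInt, if_neg (by omega), zero_mul])
  have h1 : X i ^ m = ∑ b ∈ Finset.range m.succ, hInt n ((m : ℤ) - b) * (coProd n i).coeff b := by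
    rw [← h]
    refine Finset.sum_congr rfl fun b hb => ?_
    rw [Finset.mem_range] at hb
    rw [hInt, if_pos (by omega), mul_comm]
    congr 2
    omega
  have h2 : ∑ b ∈ Finset.range m.succ, hInt n ((m : ℤ) - b) * (coProd n i).coeff b =
      ∑ b ∈ Finset.range n, hInt n ((m : ℤ) - b) * (coProd n i).coeff b := by
    have e1 := Finset.sum_filter_of_ne (s := Finset.range m.succ) (p := (· ∈ Finset.range n))
      fun b _ hb => (key b hb).1
    have e2 := Finset.sum_filter_of_ne (s := Finset.range n) (p := (· ∈ Finset.range m.succ))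
      fun b _ hb => (key b hb).2
    rw [← e1, ← e2, Finset.filter_mem_eq_inter, Finset.filter_mem_eq_inter, Finset.inter_comm]
  rw [h1, h2, ← Finset.sum_range_reflect, Finset.sum_range]
  refine Finset.sum_congr rfl fun j _ => ?_
  congr 2
  have := j.2
  omega

/-- Ratio-of-alternants formula, up to a factor that does not depend on the partition. -/
theorem det_X_pow_eq_schur_mul_det_coProd (n : ℕ) (mu : Fin n → ℕ) :
    (Matrix.of fun j l : Fin n =>
        (X l : MvPolynomial (Fin n) ℚ) ^ (mu j + (n - 1 - (j : ℕ)))).det =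
      schur n mu * (Matrix.of fun j l : Fin n => (coProd n l).coeff (n - 1 - (j : ℕ))).det := by
  rw [schur, ← Matrix.det_mul]
  congr 1
  ext1 j l
  rw [Matrix.of_apply, X_pow_eq_sum_hInt_mul, Matrix.mul_apply]
  refine Finset.sum_congr rfl fun k _ => ?_
  simp only [Matrix.of_apply]
  congr 2
  have := j.2
  omega

theorem schur_zero (n : ℕ) : schur n 0 = 1 := by
  rw [schur, Matrix.det_of_isUpperTriangular]
  · simp [hInt]
  · intro i j hij
    have hij : j < i := hij
    simp only [Matrix.of_apply, hInt, Pi.zero_apply]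
    rw [if_neg]
    have : (j : ℕ) < i := hij
    push_cast
    omega

theorem det_X_pow_eq_schur_mul (n : ℕ) (mu : Fin n → ℕ) :
    (Matrix.of fun j l : Fin n =>
        (X l : MvPolynomial (Fin n) ℚ) ^ (mu j + (n - 1 - (j : ℕ)))).det =
      schur n mu * (Matrix.of fun j l : Fin n =>
        (X l : MvPolynomial (Fin n) ℚ) ^ (n - 1 - (j : ℕ))).det := by
  have h := det_X_pow_eq_schur_mul_det_coProd n 0
  simp only [schur_zero, Pi.zero_apply, zero_add, one_mul] at h
  rw [h, det_X_pow_eq_schur_mul_det_coProd]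

theorem det_two_mul_X_pow (n : ℕ) (mu : Fin n → ℕ) :
    (Matrix.of fun j l : Fin n =>
        (2 * X l : MvPolynomial (Fin n) ℚ) ^ (mu j + (n - 1 - (j : ℕ)))).det =
      2 ^ (∑ i, mu i) * schur n mu * (Matrix.of fun j l : Fin n =>
        (2 * X l : MvPolynomial (Fin n) ℚ) ^ (n - 1 - (j : ℕ))).det := by
  have scale : ∀ k : Fin n → ℕ,
      (Matrix.of fun j l : Fin n => (2 * X l : MvPolynomial (Fin n) ℚ) ^ k j).det =
        2 ^ (∑ i, k i) * (Matrix.of fun j l : Fin n =>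
          (X l : MvPolynomial (Fin n) ℚ) ^ k j).det := by
    intro k
    rw [← Finset.prod_pow_eq_pow_sum, ← Matrix.det_mul_column]
    simp [mul_pow]
  rw [scale fun j => mu j + (n - 1 - (j : ℕ)), scale fun j => n - 1 - (j : ℕ),
    det_X_pow_eq_schur_mul, Finset.sum_add_distrib, pow_add]
  ring

theorem det_pow_reverse {R : Type*} [CommRing R] {n : ℕ} (z : Fin n → R) :
    (Matrix.of fun j l : Fin n => z l ^ (n - 1 - (j : ℕ))).det =
      ∏ i : Fin n, ∏ j ∈ Finset.Ioi i, (z i - z j) := by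
  have h := Matrix.det_projVandermonde (fun _ : Fin n => (1 : R)) z
  simp only [one_mul] at h
  rw [← h, ← Matrix.det_transpose]
  congr 1
  ext i j
  simp only [Matrix.transpose_apply, Matrix.of_apply, Matrix.projVandermonde_apply, one_pow,
    one_mul, Fin.val_rev]
  congr 1
  omega

theorem prod_filter_lt_eq {R : Type*} [CommMonoid R] {n : ℕ} (f : Fin n → Fin n → R) :
    ∏ p ∈ (Finset.univ : Finset (Fin n × Fin n)).filter (fun p => p.1 < p.2), f p.1 p.2 =
      ∏ i : Fin n, ∏ j ∈ Finset.Ioi i, f i j := by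
  rw [Finset.prod_filter, ← Finset.univ_product_univ, Finset.prod_product]
  refine Finset.prod_congr rfl fun i _ => ?_
  rw [← Finset.prod_filter]
  refine Finset.prod_congr ?_ fun _ _ => rfl
  ext j
  simp

theorem prod_prod_Ioi_two {R : Type*} [CommSemiring R] (n : ℕ) :
    ∏ i : Fin n, ∏ _j ∈ Finset.Ioi i, (2 : R) = 2 ^ n.choose 2 := by
  simp only [Finset.prod_const, Fin.card_Ioi]
  rw [Finset.prod_pow_eq_pow_sum, Fin.sum_univ_eq_sum_range (fun i => n - 1 - i),
    Finset.sum_range_reflect (fun i => i), Finset.sum_range_id, Nat.choose_two_right]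

theorem det_one_add_two_mul_X_pow (n : ℕ) :
    (Matrix.of fun j l : Fin n =>
        (1 + 2 * X l : MvPolynomial (Fin n) ℚ) ^ (2 * (n - 1 - (j : ℕ)))).det =
      (2 ^ n.choose 2 *
        ∏ p ∈ (Finset.univ : Finset (Fin n × Fin n)).filter (fun p => p.1 < p.2),
          (1 + X p.1 + X p.2)) * (Matrix.of fun j l : Fin n =>
        (2 * X l : MvPolynomial (Fin n) ℚ) ^ (n - 1 - (j : ℕ))).det := by
  simp only [pow_mul]
  rw [det_pow_reverse fun l => (1 + 2 * X l : MvPolynomial (Fin n) ℚ) ^ 2,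
    det_pow_reverse fun l => (2 * X l : MvPolynomial (Fin n) ℚ),
    prod_filter_lt_eq fun i j => (1 + X i + X j : MvPolynomial (Fin n) ℚ), ← prod_prod_Ioi_two]
  simp only [← Finset.prod_mul_distrib]
  refine Finset.prod_congr rfl fun i _ => Finset.prod_congr rfl fun j _ => ?_
  ring

theorem det_two_mul_X_pow_reverse_ne_zero (n : ℕ) :
    (Matrix.of fun j l : Fin n =>
      (2 * X l : MvPolynomial (Fin n) ℚ) ^ (n - 1 - (j : ℕ))).det ≠ 0 := by
  rw [det_pow_reverse fun l => (2 * X l : MvPolynomial (Fin n) ℚ)]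
  refine Finset.prod_ne_zero_iff.2 fun i _ => Finset.prod_ne_zero_iff.2 fun j hj => ?_
  rw [← mul_sub]
  refine mul_ne_zero two_ne_zero (sub_ne_zero.2 fun h => ?_)
  exact (Finset.mem_Ioi.1 hj).ne (X_injective h)

/-- A square matrix with a zero block of rows `≥ a` and columns `≤ a` is singular. -/
theorem Matrix.det_eq_zero_of_zero_block {R : Type*} [CommRing R] {n : ℕ}
    (M : Matrix (Fin n) (Fin n) R) (a : Fin n) (h : ∀ i j, a ≤ i → j ≤ a → M i j = 0) :
    M.det = 0 := by
  rw [Matrix.det_apply]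
  refine Finset.sum_eq_zero fun σ _ => ?_
  obtain ⟨j, hj, hσ⟩ : ∃ j ≤ a, a ≤ σ j := by
    by_contra! hc
    have := Finset.card_le_card_of_injOn (s := Finset.Iic a) (t := Finset.Iio a) σ
      (fun j hj => by simpa using hc j (by simpa using hj)) σ.injective.injOn
    simp at this
  have hprod : ∏ i, M (σ i) i = 0 := Finset.prod_eq_zero (Finset.mem_univ j) (h _ _ hσ hj)
  rw [hprod, smul_zero]

theorem StrictAnti.sub_le_apply {n : ℕ} {g : Fin n → ℕ} (hg : StrictAnti g) (j : Fin n) :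
    n - 1 - (j : ℕ) ≤ g j := by
  have := Finset.card_le_card_of_injOn (s := Finset.Ioi j) (t := Finset.range (g j)) g
    (fun i hi => by simpa using hg (by simpa using hi)) hg.injective.injOn
  simpa using this

theorem StrictAnti.antitone_sub {n : ℕ} {g : Fin n → ℕ} (hg : StrictAnti g) :
    Antitone fun j : Fin n => g j - (n - 1 - (j : ℕ)) := by
  cases n with
  | zero => exact fun i => i.elim0
  | succ n =>
    refine Fin.antitone_iff_succ_le.2 fun i => ?_
    have h := hg (Fin.castSucc_lt_succ (i := i))
    have := i.2
    simp only [Fin.val_succ, Fin.val_castSucc]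
    omega

theorem det_choose_eq_zero {n : ℕ} {g : Fin n → ℕ} (hg : StrictAnti g) (a : Fin n)
    (ha : 2 * (n - 1 - (a : ℕ)) < g a) :
    (Matrix.of fun i j : Fin n =>
      (((2 * (n - 1 - (i : ℕ))).choose (g j) : ℕ) : MvPolynomial (Fin n) ℚ)).det = 0 := by
  refine Matrix.det_eq_zero_of_zero_block _ a fun i j hi hj => ?_
  have h1 := hg.antitone hj
  have h2 : (a : ℕ) ≤ i := hi
  rw [Matrix.of_apply, Nat.choose_eq_zero_of_lt (by omega), Nat.cast_zero]

theorem binomDet_staircase_cast (n : ℕ) (mu : Fin n → ℕ) :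
    (binomDet n (staircase n) mu : MvPolynomial (Fin n) ℚ) =
      (Matrix.of fun i j : Fin n => (((2 * (n - 1 - (i : ℕ))).choose
        (mu j + (n - 1 - (j : ℕ))) : ℕ) : MvPolynomial (Fin n) ℚ)).det := by
  rw [binomDet, Int.cast_det]
  congr 1
  ext1 i j
  simp [staircase, two_mul]

open scoped Classical in
theorem stmt3 (n : ℕ) :
    (2 : MvPolynomial (Fin n) ℚ) ^ n.choose 2 *
        ∏ p ∈ (Finset.univ : Finset (Fin n × Fin n)).filter (fun p => p.1 < p.2),
          (1 + X p.1 + X p.2) =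
      ∑ mu ∈ (Finset.Iic (staircase n)).filter (fun mu => Antitone mu),
        (binomDet n (staircase n) mu : MvPolynomial (Fin n) ℚ) * 2 ^ (∑ i, mu i) *
          schur n mu := by
  refine mul_right_cancel₀ (det_two_mul_X_pow_reverse_ne_zero n) ?_
  have expand : (Matrix.of fun j l : Fin n =>
      (1 + 2 * X l : MvPolynomial (Fin n) ℚ) ^ (2 * (n - 1 - (j : ℕ)))) =
      Matrix.of fun j l : Fin n => ∑ k ∈ Finset.range (2 * n),
        (((2 * (n - 1 - (j : ℕ))).choose k : ℕ) : MvPolynomial (Fin n) ℚ) * (2 * X l) ^ k := by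
    ext1 j l
    have := j.2
    simp only [Matrix.of_apply]
    rw [add_comm, add_pow]
    refine (Finset.sum_congr rfl fun k _ => by rw [one_pow, mul_one, mul_comm]).trans
      (Finset.sum_subset (Finset.range_subset_range.2 (by omega)) fun k _ hk => ?_)
    rw [Nat.choose_eq_zero_of_lt (by simpa using hk), Nat.cast_zero, zero_mul]
  rw [← det_one_add_two_mul_X_pow, expand,
    det_sum_mul_eq_sum_strictAnti (Finset.range (2 * n))
      (fun j k => (((2 * (n - 1 - (j : ℕ))).choose k : ℕ) : MvPolynomial (Fin n) ℚ))
      (fun k l => (2 * X l) ^ k), Finset.sum_mul]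
  symm
  refine Finset.sum_of_injOn (fun mu j => mu j + (n - 1 - (j : ℕ))) ?_ ?_ ?_ ?_
  · intro mu _ nu _ h
    ext j
    simpa using congrFun h j
  · intro mu hmu
    simp only [Finset.coe_filter, Finset.mem_Iic, Set.mem_ofPred_eq, Fintype.mem_piFinset,
      Finset.mem_range] at hmu ⊢
    refine ⟨fun j => ?_, fun i j hij => ?_⟩
    · have h1 : mu j ≤ n - 1 - (j : ℕ) := hmu.1 j
      have := j.2
      omega
    · have h1 := hmu.2 hij.le
      have h2 : (i : ℕ) < j := hij
      have := j.2
      simp only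
      omega
  · intro g hg hnot
    have hg : StrictAnti g := (Finset.mem_filter.1 hg).2
    obtain ⟨a, ha⟩ : ∃ a : Fin n, 2 * (n - 1 - (a : ℕ)) < g a := by
      by_contra! hc
      refine hnot ⟨fun j => g j - (n - 1 - (j : ℕ)), ?_, ?_⟩
      · simp only [Finset.coe_filter, Finset.mem_Iic, Set.mem_ofPred_eq]
        refine ⟨fun j => ?_, hg.antitone_sub⟩
        have := hc j
        simp only [staircase]
        omega
      · ext j
        exact Nat.sub_add_cancel (hg.sub_le_apply j)
    rw [det_choose_eq_zero hg a ha, zero_mul]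
  · intro mu _
    rw [det_two_mul_X_pow, binomDet_staircase_cast]
    ring
end

section
/- For n ≥ 2, B_{n,n−1}(x_1,…,x_n) = ∑_{λ ⊢ n} a_λ · s_λ(x_1,…,x_n), where for each partition λ of n (with at most n parts) the coefficient a_λ is the number of standard Young tableaux T of shape λ whose smallest ascent is an even number. -/
open MvPolynomial

/-- The `(n,k)`-th Boolean product polynomial. -/
noncomputable def booleanProd (n k : ℕ) : MvPolynomial (Fin n) ℚ :=
  ∏ S ∈ (Finset.univ : Finset (Fin n)).powersetCard k, ∑ i ∈ S, X i

/-- `T` is a standard Young tableau of shape `lam ⊢ n` (French notation: row `0`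
is the bottom row, `T (i, j)` is the entry in row `i` and column `j`, both
`0`-indexed).  Entries are `1, …, n`, each used exactly once, increasing left to
right along rows and increasing bottom to top along columns; entries outside
the diagram are normalized to `0`. -/
def IsSYT (n : ℕ) (lam : Fin n → ℕ) (T : Fin n × ℕ → ℕ) : Prop :=
  (∀ i j, lam i ≤ j → T (i, j) = 0) ∧
  (∀ i j, j + 1 < lam i → T (i, j) < T (i, j + 1)) ∧
  (∀ i i' : Fin n, ∀ j, i < i' → j < lam i' → j < lam i → T (i, j) < T (i', j)) ∧
  Set.BijOn T {p : Fin n × ℕ | p.2 < lam p.1} (Set.Icc 1 n)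

/-- The entry `i` of the tableau `T` is an ascent: either `i = n`, or `i + 1`
does not lie in a row strictly above the row of `i`. -/
def IsAscent (n : ℕ) (lam : Fin n → ℕ) (T : Fin n × ℕ → ℕ) (i : ℕ) : Prop :=
  i = n ∨ ∀ r r' : Fin n, ∀ j j' : ℕ, j < lam r → j' < lam r' →
    T (r, j) = i → T (r', j') = i + 1 → r' ≤ r

/-- The smallest ascent of `T` is an even number. -/
def SmallestAscentEven (n : ℕ) (lam : Fin n → ℕ) (T : Fin n × ℕ → ℕ) : Prop :=
  ∃ e, Even e ∧ IsLeast {i | 1 ≤ i ∧ i ≤ n ∧ IsAscent n lam T i} e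

/-- The number of standard Young tableaux of shape `lam` whose smallest ascent
is even. -/
noncomputable def aCoeff (n : ℕ) (lam : Fin n → ℕ) : ℕ :=
  Nat.card {T : Fin n × ℕ → ℕ // IsSYT n lam T ∧ SmallestAscentEven n lam T}

theorem coeff_hsymm_eq_ite {σ : Type*} [Fintype σ] [DecidableEq σ] (R : Type*) [CommSemiring R]
    (r : ℕ) (d : σ →₀ ℕ) : coeff d (hsymm σ R r) = if d.degree = r then 1 else 0 := by
  have hX : ∀ s : Multiset σ, (s.map (X : σ → MvPolynomial σ R)).prod
      = monomial (Multiset.toFinsupp s) 1 := by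
    intro s
    induction s using Multiset.induction_on with
    | empty => simp
    | cons a s ih =>
      rw [Multiset.map_cons, Multiset.prod_cons, ih, ← Multiset.singleton_add, map_add,
        Multiset.toFinsupp_singleton, X, monomial_mul, one_mul]
  have hdeg : ∀ s : Multiset σ, (Multiset.toFinsupp s).degree = s.card := by
    intro s
    rw [Finsupp.degree_eq_sum, ← Multiset.toFinsupp_toMultiset s, Finsupp.card_toMultiset,
      Multiset.toFinsupp_toMultiset, Finsupp.sum_fintype _ _ fun _ => rfl]
    rfl
  simp only [hsymm, coeff_sum, hX, coeff_monomial]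
  split_ifs with h
  · have hc : (Finsupp.toMultiset d).card = r := by
      rw [← h, ← hdeg, Finsupp.toMultiset_toFinsupp]
    refine (Finset.sum_eq_single (⟨Finsupp.toMultiset d, hc⟩ : Sym σ r) ?_ ?_).trans ?_
    · rintro s - hs
      refine if_neg ?_
      rintro rfl
      exact hs (Subtype.ext (by simp))
    · intro hs
      exact absurd (@Finset.mem_univ (Sym σ r) _ _) hs
    · simp
  · refine Finset.sum_eq_zero fun s _ => if_neg ?_
    rintro rfl
    exact h ((hdeg _).trans s.2)

theorem coeff_hInt (n : ℕ) (m : ℤ) (d : Fin n →₀ ℕ) :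
    coeff d (hInt n m) = if (d.degree : ℤ) = m then 1 else 0 := by
  unfold hInt
  by_cases hm : 0 ≤ m
  · rw [if_pos hm, coeff_hsymm_eq_ite]
    congr 1
    exact propext (by omega)
  · rw [if_neg hm, if_neg (by omega), coeff_zero]

theorem hInt_of_neg (n : ℕ) {m : ℤ} (hm : m < 0) : hInt n m = 0 := if_neg (by omega)

theorem hInt_zero (n : ℕ) : hInt n 0 = 1 := by simp [hInt]

theorem sum_esymm_mul_hInt (n : ℕ) {m : ℤ} (hm : m ≠ 0) :
    ∑ k ∈ Finset.range (n + 1), (-1) ^ k * esymm (Fin n) ℚ k * hInt n (m - k) = 0 := by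
  have key : ∑ S ∈ (Finset.univ : Finset (Fin n)).powerset,
      (-1) ^ S.card * (∏ i ∈ S, X i) * hInt n (m - S.card) = 0 := by
    ext d
    have hterm : ∀ S : Finset (Fin n),
        coeff d ((-1) ^ S.card * (∏ i ∈ S, X i) * hInt n (m - S.card)) =
          if S ⊆ d.support then (if (d.degree : ℤ) = m then (-1) ^ S.card else 0) else 0 := by
      intro S
      have h1 : (-1 : MvPolynomial (Fin n) ℚ) ^ S.card * (∏ i ∈ S, X i) =
          monomial (∑ i ∈ S, Finsupp.single i 1) ((-1) ^ S.card) := by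
        rw [monomial_sum_index]
        simp [X]
      have hle : (∑ i ∈ S, Finsupp.single i 1 ≤ d) ↔ S ⊆ d.support := by
        rw [Finsupp.le_def]
        simp only [Finsupp.finsetSum_apply, Finsupp.single_apply, Finset.sum_ite_eq']
        constructor
        · intro h i hi
          have := h i
          rw [if_pos hi] at this
          simp; omega
        · intro h i
          split_ifs with hi
          · have := h hi
            simp at this; omega
          · omega
      rw [h1, coeff_monomial_mul', coeff_hInt]
      simp only [hle]
      split_ifs with hS h2 h3 h3 <;> try simp
      all_goals
        have hd : d.degree = S.card + (d - ∑ i ∈ S, Finsupp.single i 1).degree := by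
          conv_lhs => rw [← add_tsub_cancel_of_le (hle.2 hS)]
          simp
        omega
    simp only [coeff_sum, hterm, coeff_zero]
    rw [← Finset.sum_filter]
    by_cases hd : (d.degree : ℤ) = m
    · have hne : d.support.Nonempty := by
        rw [Finsupp.support_nonempty_iff]
        rintro rfl
        simp at hd
        exact hm hd.symm
      have hset : (Finset.univ : Finset (Fin n)).powerset.filter (· ⊆ d.support)
          = d.support.powerset := by
        ext; simp
      simp only [hset, if_pos hd]
      have := Finset.sum_powerset_neg_one_pow_card_of_nonempty hne
      exact_mod_cast this
    · simp [hd]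
  rw [Finset.sum_powerset, Finset.card_univ, Fintype.card_fin] at key
  rw [← key]
  refine Finset.sum_congr rfl fun k _ => ?_
  rw [esymm, Finset.mul_sum, Finset.sum_mul]
  refine Finset.sum_congr rfl fun S hS => ?_
  rw [(Finset.mem_powersetCard.1 hS).2]

theorem hInt_eq_sum (n : ℕ) {m : ℤ} (hm : m ≠ 0) :
    hInt n m = ∑ k : Fin n, (-1) ^ (k : ℕ) * esymm (Fin n) ℚ (k + 1) * hInt n (m - k - 1) := by
  have h := sum_esymm_mul_hInt n hm
  rw [Finset.sum_range_succ', ← Fin.sum_univ_eq_sum_range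
    (fun k => (-1) ^ (k + 1) * esymm (Fin n) ℚ (k + 1) * hInt n (m - (k + 1 : ℕ)))] at h
  simp only [pow_zero, esymm_zero, Nat.cast_zero, sub_zero, one_mul] at h
  rw [← sub_eq_zero, ← h, sub_eq_add_neg, add_comm, ← Finset.sum_neg_distrib]
  congr 1
  refine Finset.sum_congr rfl fun k _ => ?_
  push_cast
  rw [sub_sub]
  ring

/-- Pieri rule for adding one box; the summands whose shape is not a partition vanish. -/
theorem sum_X_mul_schur (n : ℕ) (lam : Fin n → ℕ) :
    (∑ i, X i) * schur n lam = ∑ i, schur n (lam + Pi.single i 1) := by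
  rcases n with _ | n
  · simp
  set M : Matrix (Fin (n + 1)) (Fin (n + 1)) (MvPolynomial (Fin (n + 1)) ℚ) :=
    Matrix.of fun i j => hInt (n + 1) ((lam i : ℤ) - (i : ℤ) + (j : ℤ)) with hM
  let c : Fin (n + 1) → Fin (n + 1) → MvPolynomial (Fin (n + 1)) ℚ :=
    fun j i => hInt (n + 1) ((lam i : ℤ) - (i : ℤ) + (j : ℤ) + 1)
  have hrow : ∀ i, schur (n + 1) (lam + Pi.single i 1) = (M.updateRow i (fun j => c j i)).det := by
    intro i
    rw [schur]
    congr 1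
    ext1 k j
    by_cases hk : k = i
    · subst hk
      simp [c]
      congr 1; ring
    · simp [hk, hM]
  have hswap : ∑ i, (M.updateRow i (fun j => c j i)).det = ∑ j, (M.updateCol j (c j)).det := by
    simp only [Matrix.det_apply]
    rw [Finset.sum_comm, Finset.sum_comm (s := Finset.univ (α := Fin (n + 1)))]
    refine Finset.sum_congr rfl fun σ _ => ?_
    rw [← Equiv.sum_comp σ]
    refine Finset.sum_congr rfl fun j _ => ?_
    congr 1
    refine Finset.prod_congr rfl fun k _ => ?_
    rw [Matrix.updateRow_apply, Matrix.updateCol_apply]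
    by_cases hk : k = j
    · simp [hk]
    · simp [hk]
  have hzero : ∀ j, j ≠ Fin.last n → (M.updateCol j (c j)).det = 0 := by
    intro j hj
    obtain ⟨j, rfl⟩ := Fin.exists_castSucc_eq.2 hj
    refine Matrix.det_zero_of_column_eq (i := j.castSucc) (j := j.succ) (by simp [Fin.ext_iff]) ?_
    intro i
    have : j.succ ≠ j.castSucc := by simp [Fin.ext_iff]
    rw [Matrix.updateCol_self, Matrix.updateCol_ne this]
    simp [c, hM]
    congr 1; ring
  have hlast : (M.updateCol (Fin.last n) (c (Fin.last n))).det = (∑ i, X i) * M.det := by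
    let e : Fin (n + 1) → MvPolynomial (Fin (n + 1)) ℚ :=
      fun j => (-1) ^ (j.rev : ℕ) * esymm (Fin (n + 1)) ℚ (j.rev + 1)
    have hc : c (Fin.last n) = fun k => ∑ j, e j • M k j := by
      funext k
      simp only [c]
      rw [hInt_eq_sum _ (by simp; omega), ← Equiv.sum_comp Fin.revPerm]
      refine Finset.sum_congr rfl fun j _ => ?_
      simp only [e, hM, smul_eq_mul, Fin.revPerm_apply, Matrix.of_apply]
      congr 2
      have := Fin.val_rev j
      simp; omega
    rw [hc, Matrix.det_updateCol_sum]
    simp [e, esymm_one]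
  simp only [hrow]
  rw [hswap, Finset.sum_eq_single (Fin.last n) (fun j _ hj => hzero j hj) (by simp), hlast]
  rfl

theorem schur_add_single_eq_zero (n : ℕ) (lam : Fin n → ℕ) (hl : Antitone lam) (i : Fin n)
    (h : ¬ Antitone (lam + Pi.single i 1)) : schur n (lam + Pi.single i 1) = 0 := by
  rcases n with _ | n
  · exact i.elim0
  rw [Fin.antitone_iff_succ_le] at h hl
  push Not at h
  obtain ⟨j, hj⟩ := h
  have := hl j
  have hij : i = j.succ := by
    by_contra hne
    simp [Pi.single_apply, Ne.symm hne] at hj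
    omega
  subst hij
  have hne : j.castSucc ≠ j.succ := by simp [Fin.ext_iff]
  refine Matrix.det_zero_of_row_eq hne ?_
  funext k
  simp [hne] at hj ⊢
  congr 1
  omega

theorem schur_column (n : ℕ) (i : Fin n) :
    schur n (fun k => if k ≤ i then 1 else 0) = esymm (Fin n) ℚ (i + 1) := by
  rcases n with _ | n
  · exact i.elim0
  let U : Matrix (Fin (n + 1)) (Fin (n + 1)) (MvPolynomial (Fin (n + 1)) ℚ) :=
    Matrix.of fun i j => hInt (n + 1) ((j : ℤ) - (i : ℤ))
  have hU : U.det = 1 := by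
    rw [Matrix.det_of_isUpperTriangular]
    · simp [U, hInt_zero]
    · intro a b hab
      exact hInt_of_neg _ (by simp at hab ⊢; omega)
  let e : Fin (n + 1) → MvPolynomial (Fin (n + 1)) ℚ :=
    fun j => (-1) ^ (j : ℕ) * esymm (Fin (n + 1)) ℚ (j + 1)
  rw [schur]
  set M : Matrix (Fin (n + 1)) (Fin (n + 1)) (MvPolynomial (Fin (n + 1)) ℚ) :=
    Matrix.of fun k j => hInt (n + 1) (((if k ≤ i then 1 else 0 : ℕ) : ℤ) - (k : ℤ) + (j : ℤ))
    with hM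
  have hperm : M.submatrix (Fin.cycleRange i) id = U.updateRow i (∑ k, e k • U k) := by
    ext1 k j
    rcases lt_trichotomy k i with hk | rfl | hk
    · rw [Matrix.submatrix_apply, Fin.cycleRange_of_lt hk, Matrix.updateRow_ne hk.ne]
      have hv : ((k + 1 : Fin (n + 1)) : ℕ) = k + 1 := by
        rw [Fin.val_add_one_of_lt (lt_of_lt_of_le hk (Fin.le_last _))]
      have hle : k + 1 ≤ i := by rw [Fin.le_def, hv]; exact hk
      simp only [hM, U, Matrix.of_apply, if_pos hle, hv, id]
      congr 1; push_cast; ring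
    · rw [Matrix.submatrix_apply, Fin.cycleRange_of_eq rfl, Matrix.updateRow_self]
      simp only [hM, U, Matrix.of_apply, Fin.zero_le, if_true, id, Finset.sum_apply, Pi.smul_apply]
      rw [hInt_eq_sum _ (by simp; omega)]
      refine Finset.sum_congr rfl fun l _ => ?_
      simp only [e, smul_eq_mul]
      congr 2
      simp; ring
    · rw [Matrix.submatrix_apply, Fin.cycleRange_of_gt hk, Matrix.updateRow_ne hk.ne']
      simp only [hM, U, Matrix.of_apply, if_neg (not_le.2 hk), id]
      congr 1; push_cast; ring
  have h1 := congrArg Matrix.det hperm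
  rw [Matrix.det_permute, Matrix.det_updateRow_sum, hU, Fin.sign_cycleRange] at h1
  simp [e] at h1
  exact h1

/-- The analogue of `IsSYT` for tableaux with `n` rows allowed and entries `1, …, m`. -/
def IsSYTOfSize (n m : ℕ) (lam : Fin n → ℕ) (T : Fin n × ℕ → ℕ) : Prop :=
  (∀ i j, lam i ≤ j → T (i, j) = 0) ∧
  (∀ i j, j + 1 < lam i → T (i, j) < T (i, j + 1)) ∧
  (∀ i i' : Fin n, ∀ j, i < i' → j < lam i' → j < lam i → T (i, j) < T (i', j)) ∧
  Set.BijOn T {p : Fin n × ℕ | p.2 < lam p.1} (Set.Icc 1 m)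

theorem IsSYTOfSize.le {n m : ℕ} {lam : Fin n → ℕ} {T : Fin n × ℕ → ℕ}
    (h : IsSYTOfSize n m lam T) (p : Fin n × ℕ) : T p ≤ m := by
  by_cases hp : p.2 < lam p.1
  · exact (h.2.2.2.mapsTo hp).2
  · rw [h.1 p.1 p.2 (not_lt.1 hp)]
    exact Nat.zero_le _

theorem IsSYTOfSize.lt_of_ne_zero {n m : ℕ} {lam : Fin n → ℕ} {T : Fin n × ℕ → ℕ}
    (h : IsSYTOfSize n m lam T) {i : Fin n} {j : ℕ} (hT : T (i, j) ≠ 0) : j < lam i := by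
  by_contra hj
  exact hT (h.1 i j (not_lt.1 hj))

theorem setOf_lt_add_single {n : ℕ} (lam : Fin n → ℕ) (i : Fin n) :
    {p : Fin n × ℕ | p.2 < (lam + Pi.single i 1 : Fin n → ℕ) p.1} =
      insert (i, lam i) {p : Fin n × ℕ | p.2 < lam p.1} := by
  ext ⟨a, b⟩
  simp only [Set.mem_ofPred_eq, Set.mem_insert_iff, Prod.mk.injEq, Pi.add_apply]
  by_cases ha : a = i
  · subst ha; simp; omega
  · simp [ha]

theorem IsSYTOfSize.update {n m : ℕ} {lam : Fin n → ℕ} {T : Fin n × ℕ → ℕ}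
    (hl : Antitone lam) (h : IsSYTOfSize n m lam T) (i : Fin n) :
    IsSYTOfSize n (m + 1) (lam + Pi.single i 1) (Function.update T (i, lam i) (m + 1)) := by
  have hle := h.le
  obtain ⟨h1, h2, h3, h4⟩ := h
  have hmem : ∀ a b, b < (lam + Pi.single i 1 : Fin n → ℕ) a ↔ (a = i ∧ b = lam i) ∨ b < lam a := by
    intro a b
    have := Set.ext_iff.1 (setOf_lt_add_single lam i) (a, b)
    simpa using this
  refine ⟨?_, ?_, ?_, ?_⟩
  · intro a b hb
    rw [← not_lt, hmem] at hb
    push Not at hb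
    rw [Function.update_of_ne (by simp; tauto), h1 a b hb.2]
  · intro a b hb
    rw [hmem] at hb
    have hne : (a, b) ≠ (i, lam i) := by
      rintro ⟨⟩
      rcases hb with hb | hb <;> omega
    rw [Function.update_of_ne hne]
    by_cases hnew : (a, b + 1) = (i, lam i)
    · rw [hnew, Function.update_self]
      exact Nat.lt_succ_of_le (hle _)
    · rw [Function.update_of_ne hnew]
      refine h2 a b (hb.resolve_left fun hb => hnew ?_)
      rw [hb.1, hb.2]
  · intro a a' b haa hb' hb
    rw [hmem] at hb hb'
    have hne : (a, b) ≠ (i, lam i) := by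
      rintro ⟨⟩
      rcases hb' with hb' | hb'
      · exact haa.ne' hb'.1
      · exact absurd (hl haa.le) (not_le.2 hb')
    rw [Function.update_of_ne hne]
    by_cases hnew : (a', b) = (i, lam i)
    · rw [hnew, Function.update_self]
      exact Nat.lt_succ_of_le (hle _)
    · rw [Function.update_of_ne hnew]
      refine h3 a a' b haa (hb'.resolve_left fun hb => hnew ?_) (hb.resolve_left fun hb => hne ?_)
      · rw [hb.1, hb.2]
      · rw [hb.1, hb.2]
  · have hins : Set.Icc 1 (m + 1) = insert (m + 1) (Set.Icc 1 m) := by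
      ext; simp; omega
    have hcongr : Set.BijOn (Function.update T (i, lam i) (m + 1))
        {p : Fin n × ℕ | p.2 < lam p.1} (Set.Icc 1 m) := by
      refine h4.congr fun p hp => (Function.update_of_ne ?_ _ _).symm
      rintro rfl
      simp at hp
    have := hcongr.insert (a := (i, lam i)) (by simp)
    rwa [Function.update_self, ← hins, ← setOf_lt_add_single] at this

theorem IsSYTOfSize.exists_update {n m : ℕ} {lam : Fin n → ℕ} {T : Fin n × ℕ → ℕ}
    (hl : Antitone lam) (h : IsSYTOfSize n (m + 1) lam T) :
    ∃ lam' T' i, Antitone lam' ∧ IsSYTOfSize n m lam' T' ∧ lam = lam' + Pi.single i 1 ∧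
      T = Function.update T' (i, lam' i) (m + 1) := by
  have hle := h.le
  obtain ⟨h1, h2, h3, h4⟩ := h
  obtain ⟨⟨i, j⟩, hj, hT⟩ := h4.surjOn (show m + 1 ∈ Set.Icc 1 (m + 1) by simp)
  have hj' : lam i = j + 1 := by
    by_contra hne
    have := h2 i j (by simp at hj; omega)
    have := hle (i, j + 1)
    omega
  have habove : ∀ b, i < b → lam b ≤ j := by
    intro b hb
    by_contra hjb
    have := h3 i b j hb (by omega) hj
    have := hle (b, j)
    omega
  have hlam : lam = Function.update lam i j + Pi.single i 1 := by
    funext a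
    by_cases ha : a = i
    · subst ha; simp [hj']
    · simp [ha]
  have hset := setOf_lt_add_single (Function.update lam i j) i
  rw [← hlam, Function.update_self] at hset
  have hmem : ∀ a b, b < Function.update lam i j a → (a, b) ≠ (i, j) := by
    rintro a b hb ⟨⟩
    simp at hb
  have hsub : ∀ a b, b < Function.update lam i j a → b < lam a := by
    intro a b hb
    rw [hlam]
    exact Nat.lt_add_right _ hb
  refine ⟨Function.update lam i j, Function.update T (i, j) 0, i, ?_, ⟨?_, ?_, ?_, ?_⟩, hlam, ?_⟩
  · intro a b hab
    rcases hab.eq_or_lt with rfl | hab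
    · exact le_rfl
    have := hl hab.le
    by_cases hb : b = i
    · subst hb
      rw [Function.update_self, Function.update_of_ne hab.ne]
      omega
    · rw [Function.update_of_ne hb]
      by_cases ha : a = i
      · subst ha
        rw [Function.update_self]
        exact habove b hab
      · rwa [Function.update_of_ne ha]
  · intro a b hb
    by_cases hab : (a, b) = (i, j)
    · rw [hab, Function.update_self]
    · rw [Function.update_of_ne hab]
      refine h1 a b (not_lt.1 fun hlt => ?_)
      have : (a, b) ∈ {p : Fin n × ℕ | p.2 < lam p.1} := hlt
      rw [hset] at this
      exact absurd (this.resolve_left hab) (not_lt.2 hb)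
  · intro a b hb
    rw [Function.update_of_ne (hmem _ _ hb), Function.update_of_ne (hmem _ _ (by omega))]
    exact h2 a b (hsub _ _ hb)
  · intro a a' b haa hb' hb
    rw [Function.update_of_ne (hmem _ _ hb), Function.update_of_ne (hmem _ _ hb')]
    exact h3 a a' b haa (hsub _ _ hb') (hsub _ _ hb)
  · have hT' : Set.BijOn T {p : Fin n × ℕ | p.2 < Function.update lam i j p.1} (Set.Icc 1 m) := by
      have := h4.sdiff_singleton (a := (i, j)) hj
      rw [hT] at this
      convert this using 1
      · rw [hset, Set.insert_sdiff_self_of_notMem]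
        simp
      · ext; simp
    exact hT'.congr fun p hp => (Function.update_of_ne (hmem _ _ hp) _ _).symm
  · rw [Function.update_self, Function.update_idem, ← hT, Function.update_eq_self]

open scoped Classical in
/-- All pairs of a shape with at most `n` rows and a standard tableau of that shape with entries
`1, …, m`, built up one box at a time. -/
noncomputable def sytFinset (n : ℕ) : ℕ → Finset ((Fin n → ℕ) × (Fin n × ℕ → ℕ))
  | 0 => {(0, 0)}
  | m + 1 => ((sytFinset n m ×ˢ Finset.univ).filter
      (fun q : ((Fin n → ℕ) × (Fin n × ℕ → ℕ)) × Fin n =>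
        Antitone (q.1.1 + Pi.single q.2 1))).image
      (fun q => (q.1.1 + Pi.single q.2 1, Function.update q.1.2 (q.2, q.1.1 q.2) (m + 1)))

theorem mem_sytFinset (n m : ℕ) (lam : Fin n → ℕ) (T : Fin n × ℕ → ℕ) :
    (lam, T) ∈ sytFinset n m ↔ Antitone lam ∧ IsSYTOfSize n m lam T := by
  induction m generalizing lam T with
  | zero =>
    rw [sytFinset, Finset.mem_singleton, Prod.mk.injEq]
    constructor
    · rintro ⟨rfl, rfl⟩
      refine ⟨antitone_const, ?_, ?_, ?_, ?_⟩ <;> simp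
    · rintro ⟨-, h⟩
      have hT : T = 0 := funext fun p => Nat.le_zero.1 (h.le p)
      refine ⟨?_, hT⟩
      funext i
      by_contra hne
      have := (h.2.2.2.mapsTo (show (i, 0) ∈ {p : Fin n × ℕ | p.2 < lam p.1} from
        Nat.pos_of_ne_zero hne))
      simp [hT] at this
  | succ m ih =>
    simp only [sytFinset, Finset.mem_image, Finset.mem_filter, Finset.mem_product,
      Finset.mem_univ, and_true, Prod.mk.injEq]
    constructor
    · rintro ⟨⟨⟨lam', T'⟩, i⟩, ⟨hmem, hanti⟩, rfl, rfl⟩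
      obtain ⟨hl, hs⟩ := (ih lam' T').1 hmem
      exact ⟨hanti, hs.update hl i⟩
    · rintro ⟨hl, hs⟩
      obtain ⟨lam', T', i, hl', hs', rfl, rfl⟩ := hs.exists_update hl
      exact ⟨⟨⟨lam', T'⟩, i⟩, ⟨(ih lam' T').2 ⟨hl', hs'⟩, hl⟩, rfl, rfl⟩

open scoped Classical in
theorem sum_sytFinset_succ {M : Type*} [AddCommMonoid M] (n m : ℕ)
    (f : (Fin n → ℕ) × (Fin n × ℕ → ℕ) → M) :
    ∑ q ∈ sytFinset n (m + 1), f q = ∑ p ∈ sytFinset n m, ∑ i : Fin n,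
      if Antitone (p.1 + Pi.single i 1) then
        f (p.1 + Pi.single i 1, Function.update p.2 (i, p.1 i) (m + 1)) else 0 := by
  rw [sytFinset, Finset.sum_image, Finset.sum_filter, Finset.sum_product]
  rintro ⟨⟨lam, T⟩, i⟩ hp ⟨⟨lam', T'⟩, i'⟩ hp' heq
  simp only [Finset.coe_filter, Finset.mem_product, Finset.mem_univ, and_true, Set.mem_ofPred_eq,
    mem_sytFinset] at hp hp'
  simp only [Prod.mk.injEq] at heq
  obtain ⟨hlam, hT⟩ := heq
  have hcell : (i, lam i) = (i', lam' i') := by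
    by_contra hne
    have := congrFun hT (i, lam i)
    rw [Function.update_self, Function.update_of_ne hne] at this
    have := hp'.1.2.le (i, lam i)
    omega
  obtain rfl : i = i' := congrArg Prod.fst hcell
  obtain rfl : lam = lam' := add_right_cancel hlam
  obtain rfl : T = T' := by
    funext p
    by_cases hpc : p = (i, lam i)
    · rw [hpc, hp.1.2.1 _ _ le_rfl, hp'.1.2.1 _ _ le_rfl]
    · simpa [hpc] using congrFun hT p
  rfl

theorem sum_eq_of_mem_sytFinset (n m : ℕ) :
    ∀ p ∈ sytFinset n m, ∑ i, p.1 i = m := by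
  induction m with
  | zero => simp [sytFinset]
  | succ m ih =>
    intro p hp
    simp only [sytFinset, Finset.mem_image, Finset.mem_filter, Finset.mem_product] at hp
    obtain ⟨q, ⟨⟨hq, -⟩, -⟩, rfl⟩ := hp
    simp [Finset.sum_add_distrib, ih q.1 hq]

/-- The entries `1, …, j` of `T` fill the bottom of the first column. -/
def StartsWithColumn (n j : ℕ) (T : Fin n × ℕ → ℕ) : Prop :=
  ∀ k : Fin n, (k : ℕ) < j → T (k, 0) = k + 1

theorem startsWithColumn_update {n j m : ℕ} (hjm : j ≤ m) {lam : Fin n → ℕ} {T : Fin n × ℕ → ℕ}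
    (h : IsSYTOfSize n m lam T) (i : Fin n) :
    StartsWithColumn n j (Function.update T (i, lam i) (m + 1)) ↔ StartsWithColumn n j T := by
  refine forall_congr' fun k => imp_congr_right fun hk => ?_
  by_cases hc : (k, 0) = (i, lam i)
  · rw [hc, Function.update_self, h.1 i _ le_rfl]
    omega
  · rw [Function.update_of_ne hc]

theorem StartsWithColumn.eq_of_le {n m e : ℕ} {lam : Fin n → ℕ} {T : Fin n × ℕ → ℕ}
    (h : IsSYTOfSize n m lam T) (hc : StartsWithColumn n e T) {a : Fin n} {b : ℕ}
    (hb : b < lam a) (hle : T (a, b) ≤ e) (hen : e ≤ n) : b = 0 ∧ a + 1 = T (a, b) := by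
  have h1 := (h.2.2.2.mapsTo (show (a, b) ∈ {p : Fin n × ℕ | p.2 < lam p.1} from hb)).1
  have hk : T (⟨T (a, b) - 1, by omega⟩, 0) = T (a, b) := by
    rw [hc _ (by simp; omega)]
    simp; omega
  have heq := h.2.2.2.injOn (x₁ := (⟨T (a, b) - 1, by omega⟩, 0)) (x₂ := (a, b))
    (h.lt_of_ne_zero (by rw [hk]; omega)) hb hk
  rw [Prod.mk.injEq, Fin.ext_iff] at heq
  exact ⟨heq.2.symm, by rw [← heq.1]; simp; omega⟩

open scoped Classical in
theorem filter_startsWithColumn_sytFinset {n j : ℕ} (hj : j ≤ n) :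
    (sytFinset n j).filter (fun p => StartsWithColumn n j p.2) =
      {(fun k : Fin n => if (k : ℕ) < j then (1 : ℕ) else 0,
        fun p : Fin n × ℕ => if p.2 = 0 ∧ (p.1 : ℕ) < j then (p.1 : ℕ) + 1 else 0)} := by
  ext ⟨lam, T⟩
  rw [Finset.mem_filter, mem_sytFinset, Finset.mem_singleton, Prod.mk.injEq]
  constructor
  · rintro ⟨⟨hl, hs⟩, hc⟩
    change StartsWithColumn n j T at hc
    have hcell : ∀ a b, b < lam a → b = 0 ∧ (a : ℕ) < j := by
      intro a b hb
      have hm := hs.2.2.2.mapsTo (show (a, b) ∈ {p : Fin n × ℕ | p.2 < lam p.1} from hb)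
      have := hc.eq_of_le hs hb hm.2 hj
      have := hm.2
      omega
    have hpos : ∀ a : Fin n, (a : ℕ) < j → 0 < lam a := fun a ha =>
      hs.lt_of_ne_zero (by rw [hc a ha]; omega)
    constructor
    · funext a
      split_ifs with ha
      · have := hpos a ha
        by_contra hne
        have := hcell a 1 (by omega)
        omega
      · by_contra hne
        exact ha (hcell a 0 (by omega)).2
    · funext ⟨a, b⟩
      dsimp only
      split_ifs with hab
      · rw [hab.1, hc a hab.2]
      · exact hs.1 a b (not_lt.1 fun hlt => hab (hcell a b hlt))
  · rintro ⟨rfl, rfl⟩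
    refine ⟨⟨?_, ?_, ?_, ?_, ?_, ?_, ?_⟩, ?_⟩
    · intro a b hab
      dsimp only
      have : (a : ℕ) ≤ b := hab
      split_ifs <;> omega
    · intro a b hb
      dsimp only at hb ⊢
      split_ifs at hb ⊢ <;> omega
    · intro a b hb
      dsimp only at hb
      split_ifs at hb <;> omega
    · intro a a' b haa hb' hb
      have : (a : ℕ) < a' := haa
      dsimp only at hb hb' ⊢
      split_ifs at hb hb' ⊢ <;> omega
    · rintro ⟨a, b⟩ hab
      simp only [Set.mem_ofPred_eq, Set.mem_Icc] at hab ⊢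
      split_ifs at hab ⊢ <;> omega
    · rintro ⟨a, b⟩ hab ⟨a', b'⟩ hab' heq
      simp only [Set.mem_ofPred_eq] at hab hab' heq
      rw [Prod.mk.injEq, Fin.ext_iff]
      split_ifs at hab hab' heq <;> omega
    · rintro v ⟨hv1, hv2⟩
      refine ⟨(⟨v - 1, by omega⟩, 0), ?_, ?_⟩
      · simp [show v - 1 < j by omega]
      · simp [show v - 1 < j by omega]; omega
    · intro k hk
      simp [hk]

/-- In a standard tableau whose entries `1, …, e` form a column, the entry `e + 1` lies either
directly above that column or in one of its rows. -/
theorem StartsWithColumn.succ {n m e : ℕ} {lam : Fin n → ℕ} {T : Fin n × ℕ → ℕ}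
    (hl : Antitone lam) (h : IsSYTOfSize n m lam T) (hc : StartsWithColumn n e T)
    {r : Fin n} {j : ℕ} (hj : j < lam r) (hT : T (r, j) = e + 1) (hr : e ≤ (r : ℕ)) :
    StartsWithColumn n (e + 1) T := by
  have hsmall : ∀ a b, b < lam a → T (a, b) < e + 1 → (a : ℕ) < e := by
    intro a b hb hlt
    have := (hc.eq_of_le h hb (by omega) (by omega)).2
    omega
  obtain rfl : j = 0 := by
    by_contra hne
    obtain ⟨j, rfl⟩ : ∃ k, j = k + 1 := ⟨j - 1, by omega⟩
    have := h.2.1 r j hj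
    have := hsmall r j (by omega) (by omega)
    omega
  have hre : (r : ℕ) = e := by
    by_contra hne
    have hlt : (⟨e, by omega⟩ : Fin n) < r := by rw [Fin.lt_def]; simp; omega
    have hpos := lt_of_lt_of_le hj (hl hlt.le)
    have := hsmall _ _ hpos (by have := h.2.2.1 _ r 0 hlt hj hpos; omega)
    simp at this
  intro k hk
  rcases Nat.lt_succ_iff_lt_or_eq.1 hk with hk | hk
  · exact hc k hk
  · rw [show k = r from Fin.ext (by omega), hT, hre]

theorem exists_isLeast_isAscent {n : ℕ} (hn : 0 < n) {lam : Fin n → ℕ} {T : Fin n × ℕ → ℕ}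
    (hl : Antitone lam) (h : IsSYT n lam T) :
    ∃ e, e ≤ n ∧ (∀ j ≤ n, StartsWithColumn n j T ↔ j ≤ e) ∧
      IsLeast {i | 1 ≤ i ∧ i ≤ n ∧ IsAscent n lam T i} e := by
  classical
  have hs : IsSYTOfSize n n lam T := h
  let e := Nat.findGreatest (fun j => StartsWithColumn n j T) n
  have hen : e ≤ n := Nat.findGreatest_le n
  have hce : StartsWithColumn n e T :=
    Nat.findGreatest_spec (P := fun j => StartsWithColumn n j T) (Nat.zero_le n)
      (fun k hk => absurd hk (Nat.not_lt_zero _))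
  have hmax : ∀ j ≤ n, StartsWithColumn n j T → j ≤ e := fun j hj hcj =>
    Nat.le_findGreatest hj hcj
  have he1 : 1 ≤ e := by
    refine hmax 1 hn ?_
    obtain ⟨⟨r, j⟩, hj, hT⟩ := hs.2.2.2.surjOn (show 1 ∈ Set.Icc 1 n from ⟨le_rfl, hn⟩)
    exact StartsWithColumn.succ hl hs (fun k hk => absurd hk (Nat.not_lt_zero _)) hj hT
      (Nat.zero_le _)
  refine ⟨e, hen, fun j hj => ⟨hmax j hj, fun hje k hk => hce k (lt_of_lt_of_le hk hje)⟩,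
    ⟨he1, hen, ?_⟩, ?_⟩
  · refine or_iff_not_imp_left.2 fun hne r r' j j' hj hj' hT hT' => ?_
    by_contra hlt
    rw [not_le, Fin.lt_def] at hlt
    have hr := (hce.eq_of_le hs hj hT.le hen).2
    have := hmax (e + 1) (by omega) (hce.succ hl hs hj' hT' (by omega))
    omega
  · rintro i ⟨hi1, hin, hasc⟩
    by_contra hlt
    rcases hasc with rfl | hasc
    · omega
    have hk := hce ⟨i - 1, by omega⟩ (by simp; omega)
    have hk' := hce ⟨i, by omega⟩ (by simp; omega)
    have := hasc _ _ 0 0 (hs.lt_of_ne_zero (by rw [hk]; omega))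
      (hs.lt_of_ne_zero (by rw [hk']; omega)) (by rw [hk]; simp; omega) (by rw [hk'])
    rw [Fin.le_def] at this
    simp at this
    omega

open scoped Classical in
theorem sum_neg_one_pow_startsWithColumn {R : Type*} [Ring R] {n : ℕ} (hn : 0 < n)
    {lam : Fin n → ℕ} {T : Fin n × ℕ → ℕ} (hl : Antitone lam) (h : IsSYT n lam T) :
    ∑ j ∈ Finset.range (n + 1), (if StartsWithColumn n j T then (-1 : R) ^ j else 0) =
      if SmallestAscentEven n lam T then 1 else 0 := by
  obtain ⟨e, hen, hcol, hleast⟩ := exists_isLeast_isAscent hn hl h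
  have heven : SmallestAscentEven n lam T ↔ Even e :=
    ⟨fun ⟨e', he', hl'⟩ => hl'.unique hleast ▸ he', fun he => ⟨e, he, hleast⟩⟩
  rw [← Finset.sum_filter]
  have hset : (Finset.range (n + 1)).filter (fun j => StartsWithColumn n j T) =
      Finset.range (e + 1) := by
    ext j
    rw [Finset.mem_filter, Finset.mem_range, Finset.mem_range]
    constructor
    · rintro ⟨hj, hc⟩
      exact Nat.lt_succ_of_le ((hcol j (by omega)).1 hc)
    · intro hj
      exact ⟨by omega, (hcol j (by omega)).2 (by omega)⟩
  rw [hset, neg_one_geom_sum]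
  by_cases he : Even e <;> simp [heven, Nat.even_add_one, he]

theorem schur_eq_esymm {n j : ℕ} (hj : j ≤ n) :
    schur n (fun k => if (k : ℕ) < j then 1 else 0) = esymm (Fin n) ℚ j := by
  rcases j with _ | j
  · rw [esymm_zero, ← schur_zero n]
    rfl
  · simpa [Fin.le_def, Nat.lt_succ_iff] using schur_column n ⟨j, hj⟩

open scoped Classical in
theorem esymm_mul_pow_eq_sum_schur {n j m : ℕ} (hj : j ≤ n) (hjm : j ≤ m) :
    esymm (Fin n) ℚ j * (∑ i, X i) ^ (m - j) =
      ∑ p ∈ sytFinset n m, if StartsWithColumn n j p.2 then schur n p.1 else 0 := by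
  induction m, hjm using Nat.le_induction with
  | base =>
    rw [← Finset.sum_filter, filter_startsWithColumn_sytFinset hj, Finset.sum_singleton,
      schur_eq_esymm hj, Nat.sub_self, pow_zero, mul_one]
  | succ m hjm ih =>
    rw [Nat.succ_sub hjm, pow_succ, ← mul_assoc, ih, Finset.sum_mul, sum_sytFinset_succ]
    refine Finset.sum_congr rfl fun p hp => ?_
    obtain ⟨hl, hs⟩ := (mem_sytFinset n m p.1 p.2).1 hp
    simp only [startsWithColumn_update hjm hs]
    split_ifs with hc
    · rw [mul_comm, sum_X_mul_schur]
      refine Finset.sum_congr rfl fun i _ => ?_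
      split_ifs with ha
      · rfl
      · exact schur_add_single_eq_zero n p.1 hl i ha
    · simp

theorem booleanProd_eq_sum_esymm {n : ℕ} (hn : 0 < n) :
    booleanProd n (n - 1) = ∑ j ∈ Finset.range (n + 1),
      (-1) ^ j * (esymm (Fin n) ℚ j * (∑ i, X i) ^ (n - j)) := by
  have h1 : booleanProd n (n - 1) = ∏ i : Fin n, (-X i + ∑ k, X k) := by
    symm
    refine Finset.prod_bij (fun i _ => Finset.univ.erase i) ?_ ?_ ?_ ?_
    · intro i _
      simp [Finset.mem_powersetCard]
    · intro i _ i' _ h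
      by_contra hne
      have : i ∈ Finset.univ.erase i' := by simp [hne]
      rw [← h] at this
      simp at this
    · intro S hS
      have hcard : Sᶜ.card = 1 := by
        rw [Finset.card_compl, (Finset.mem_powersetCard.1 hS).2, Fintype.card_fin]
        omega
      obtain ⟨i, hi⟩ := Finset.card_eq_one.1 hcard
      refine ⟨i, Finset.mem_univ _, ?_⟩
      rw [← compl_compl S, hi]
      ext; simp
    · intro i _
      rw [← Finset.add_sum_erase _ _ (Finset.mem_univ i), neg_add_cancel_left]
  rw [h1, Finset.prod_add, Finset.sum_powerset, Finset.card_univ, Fintype.card_fin]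
  refine Finset.sum_congr rfl fun j _ => ?_
  rw [esymm, Finset.sum_mul, Finset.mul_sum]
  refine Finset.sum_congr rfl fun S hS => ?_
  have hc := (Finset.mem_powersetCard.1 hS).2
  rw [Finset.prod_neg, Finset.prod_const, Finset.card_sdiff_of_subset (Finset.subset_univ _), hc,
    Finset.card_univ, Fintype.card_fin, mul_assoc]

open scoped Classical in
theorem aCoeff_eq_card {n : ℕ} {lam : Fin n → ℕ} (hl : Antitone lam) :
    aCoeff n lam = (((sytFinset n n).filter (fun p => p.1 = lam)).filter
      (fun p => SmallestAscentEven n p.1 p.2)).card := by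
  rw [aCoeff, ← Finset.card_image_of_injOn (f := Prod.snd)]
  · refine Nat.subtype_card _ fun T => ?_
    simp only [Finset.mem_image, Finset.mem_filter]
    constructor
    · rintro ⟨⟨lam, T⟩, ⟨⟨hp, rfl⟩, ha⟩, rfl⟩
      exact ⟨((mem_sytFinset n n _ _).1 hp).2, ha⟩
    · rintro ⟨hs, ha⟩
      exact ⟨(lam, T), ⟨⟨(mem_sytFinset n n _ _).2 ⟨hl, hs⟩, rfl⟩, ha⟩, rfl⟩
  · intro p hp q hq h
    simp only [Finset.coe_filter, Finset.mem_filter, Set.mem_ofPred_eq] at hp hq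
    exact Prod.ext (hp.1.2.trans hq.1.2.symm) h

open scoped Classical in
theorem stmt9 (n : ℕ) (hn : 2 ≤ n) :
    booleanProd n (n - 1) =
      ∑ lam ∈ (Finset.Iic (fun _ : Fin n => n)).filter
          (fun lam => Antitone lam ∧ ∑ i, lam i = n),
        (aCoeff n lam : MvPolynomial (Fin n) ℚ) * schur n lam := by
  have hpos : 0 < n := by omega
  have hsum : booleanProd n (n - 1) = ∑ p ∈ sytFinset n n,
      (if SmallestAscentEven n p.1 p.2 then 1 else 0) * schur n p.1 := by
    rw [booleanProd_eq_sum_esymm hpos, Finset.sum_congr rfl fun j hj => by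
      have hj : j ≤ n := Nat.lt_succ_iff.1 (Finset.mem_range.1 hj)
      rw [esymm_mul_pow_eq_sum_schur hj hj, Finset.mul_sum], Finset.sum_comm]
    refine Finset.sum_congr rfl fun p hp => ?_
    obtain ⟨hl, hs⟩ := (mem_sytFinset n n p.1 p.2).1 hp
    rw [← sum_neg_one_pow_startsWithColumn hpos hl hs, Finset.sum_mul]
    simp only [mul_ite, ite_mul, mul_zero, zero_mul]
  rw [hsum, ← Finset.sum_fiberwise_of_maps_to (g := Prod.fst)]
  · refine Finset.sum_congr rfl fun lam hlam => ?_
    rw [aCoeff_eq_card (Finset.mem_filter.1 hlam).2.1, Finset.card_filter, Nat.cast_sum,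
      Finset.sum_mul]
    refine Finset.sum_congr rfl fun p hp => ?_
    rw [(Finset.mem_filter.1 hp).2]
    push_cast
    rfl
  · intro p hp
    have hsize := sum_eq_of_mem_sytFinset n n p hp
    rw [Finset.mem_filter, Finset.mem_Iic]
    refine ⟨fun i => ?_, ((mem_sytFinset n n p.1 p.2).1 hp).1, hsize⟩
    calc p.1 i ≤ ∑ i, p.1 i := Finset.single_le_sum (fun _ _ => Nat.zero_le _) (Finset.mem_univ i)
      _ = n := hsize
end

section
/- The coefficient of the squarefree monomial x_1·x_2···x_n in the Boolean product polynomial B_{n,n−1}(x_1,…,x_n) = ∏_{i=1}^{n} ((x_1 + ⋯ + x_n) − x_i) equals the number of derangements of an n-element set (i.e. ∑_{j=0}^{n} (−1)^j · n!/j!). -/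
open MvPolynomial

theorem sum_single_comp_eq_sum_single_iff {ι : Type*} [Fintype ι] (p : ι → ι) :
    ∑ i, Finsupp.single (p i) 1 = (∑ i, Finsupp.single i 1 : ι →₀ ℕ) ↔ p.Bijective := by
  classical
  refine ⟨fun h => ?_, fun h => h.sum_comp fun i => Finsupp.single i 1⟩
  rw [← Finite.surjective_iff_bijective]
  intro j
  by_contra! hj
  have := DFunLike.congr_fun h j
  simp [Finsupp.finsetSum_apply, Finsupp.single_apply, hj] at this

theorem coeff_prod_X_comp {ι R : Type*} [Fintype ι] [CommSemiring R] (p : ι → ι)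
    [Decidable p.Bijective] :
    coeff (∑ i, Finsupp.single i 1) (∏ i, X (p i) : MvPolynomial ι R) =
      if p.Bijective then 1 else 0 := by
  classical
  have h : (∏ i, X (p i) : MvPolynomial ι R) = monomial (∑ i, Finsupp.single (p i) 1) 1 := by
    rw [monomial_sum_one]
    rfl
  simp only [h, coeff_monomial, sum_single_comp_eq_sum_single_iff]

theorem card_filter_bijective_eq_card_derangements {ι : Type*} [Fintype ι] [DecidableEq ι]
    [DecidablePred fun p : ι → ι => p.Bijective] :
    ((Fintype.piFinset fun i : ι => Finset.univ.erase i).filter fun p => p.Bijective).card =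
      Fintype.card (derangements ι) := by
  rw [← Finset.card_univ]
  symm
  refine Finset.card_bij (fun σ _ => ⇑σ.1) ?_ ?_ ?_
  · rintro ⟨σ, hσ⟩ -
    simpa using fun i => hσ i
  · rintro σ - τ - h
    exact Subtype.ext (DFunLike.coe_injective h)
  · intro p hp
    simp only [Finset.mem_filter, Fintype.mem_piFinset, Finset.mem_erase, Finset.mem_univ,
      and_true] at hp
    exact ⟨⟨Equiv.ofBijective p hp.2, hp.1⟩, Finset.mem_univ _, rfl⟩

theorem stmt10 (n : ℕ) :
    MvPolynomial.coeff (∑ i : Fin n, Finsupp.single i 1)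
        (∏ i : Fin n, ((∑ j : Fin n, X j) - X i) : MvPolynomial (Fin n) ℚ) =
      (numDerangements n : ℚ) := by
  classical
  have h (i : Fin n) : ((∑ j : Fin n, X j) - X i : MvPolynomial (Fin n) ℚ) =
      ∑ j ∈ Finset.univ.erase i, X j :=
    (Finset.sum_erase_eq_sub (Finset.mem_univ i)).symm
  simp only [h]
  rw [Finset.prod_univ_sum, coeff_sum]
  simp only [coeff_prod_X_comp]
  rw [Finset.sum_boole, card_filter_bijective_eq_card_derangements,
    card_derangements_eq_numDerangements, Fintype.card_fin]
end
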